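/- arXiv:2311.15885 — 2 statements merged into one kernel-verified Lean document; each statement's English description precedes it below -/
import Mathlib

section
/- For every odd k ≥ 3 and every n ≥ 1, the structures 𝒞 = 𝒜(𝓕) and 𝒟 = ℬ(𝓕) built from the chained formula 𝓕 with n links agree on every sentence φ of L^k with quant(φ) ≤ (k−1)^n; equivalently, every sentence of L^k that is true in 𝒞 and false in 𝒟 has more than (k−1)^n quantifier occurrences. -/
namespace QVT

/-- A finite relational signature: a finite type of relation symbols, each with an arity. -/
structure Signature : Type 1 where
  symbols : Type
  fin : Fintype symbols
  arity : symbols → ℕ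

/-- A structure over a relational signature. -/
structure Struct (σ : Signature) : Type 1 where
  carrier : Type
  rel : (R : σ.symbols) → (Fin (σ.arity R) → carrier) → Prop

/-- First-order formulas over the signature `σ`, with variables indexed by `ℕ`
(variable `i` represents `x_{i+1}`; variables may be reused and requantified). -/
inductive Fml (σ : Signature) : Type
  | eq : ℕ → ℕ → Fml σ
  | rel : (R : σ.symbols) → (Fin (σ.arity R) → ℕ) → Fml σ
  | not : Fml σ → Fml σ
  | and : Fml σ → Fml σ → Fml σ
  | or : Fml σ → Fml σ → Fml σ
  | ex : ℕ → Fml σ → Fml σ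
  | all : ℕ → Fml σ → Fml σ

namespace Fml

variable {σ : Signature}

/-- Satisfaction of a formula in a structure under a (total) variable assignment. -/
def Sat (M : Struct σ) : (ℕ → M.carrier) → Fml σ → Prop
  | f, .eq i j => f i = f j
  | f, .rel R v => M.rel R fun m => f (v m)
  | f, .not φ => ¬ Sat M f φ
  | f, .and φ ψ => Sat M f φ ∧ Sat M f ψ
  | f, .or φ ψ => Sat M f φ ∨ Sat M f ψ
  | f, .ex i φ => ∃ a : M.carrier, Sat M (Function.update f i a) φ
  | f, .all i φ => ∀ a : M.carrier, Sat M (Function.update f i a) φ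

/-- All variables (free or bound) occurring in a formula. -/
def vars : Fml σ → Finset ℕ
  | .eq i j => {i, j}
  | .rel _ v => Finset.univ.image v
  | .not φ => vars φ
  | .and φ ψ => vars φ ∪ vars ψ
  | .or φ ψ => vars φ ∪ vars ψ
  | .ex i φ => insert i (vars φ)
  | .all i φ => insert i (vars φ)

/-- The free variables of a formula. -/
def freeVars : Fml σ → Finset ℕ
  | .eq i j => {i, j}
  | .rel _ v => Finset.univ.image v
  | .not φ => freeVars φ
  | .and φ ψ => freeVars φ ∪ freeVars ψ
  | .or φ ψ => freeVars φ ∪ freeVars ψ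
  | .ex i φ => (freeVars φ).erase i
  | .all i φ => (freeVars φ).erase i

/-- The number of quantifier occurrences in a formula. -/
def quant : Fml σ → ℕ
  | .eq _ _ => 0
  | .rel _ _ => 0
  | .not φ => quant φ
  | .and φ ψ => quant φ + quant ψ
  | .or φ ψ => quant φ + quant ψ
  | .ex _ φ => quant φ + 1
  | .all _ φ => quant φ + 1

/-- The quantifier depth (quantifier rank) of a formula. -/
def depth : Fml σ → ℕ
  | .eq _ _ => 0
  | .rel _ _ => 0
  | .not φ => depth φ
  | .and φ ψ => max (depth φ) (depth ψ)
  | .or φ ψ => max (depth φ) (depth ψ)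
  | .ex _ φ => depth φ + 1
  | .all _ φ => depth φ + 1

/-- The size (total number of symbols) of a formula. -/
def size : Fml σ → ℕ
  | .eq _ _ => 3
  | .rel R _ => 1 + σ.arity R
  | .not φ => size φ + 1
  | .and φ ψ => size φ + size ψ + 1
  | .or φ ψ => size φ + size ψ + 1
  | .ex _ φ => size φ + 2
  | .all _ φ => size φ + 2

/-- The existential-positive formulas: built from atomic formulas using only
`∧`, `∨` and `∃`. -/
def ExPos : Fml σ → Prop
  | .eq _ _ => True
  | .rel _ _ => True
  | .not _ => False
  | .and φ ψ => ExPos φ ∧ ExPos ψ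
  | .or φ ψ => ExPos φ ∧ ExPos ψ
  | .ex _ φ => ExPos φ
  | .all _ _ => False

end Fml

/-- `φ` is a formula of `L^k`: it only uses the variables `x_1, …, x_k`
(indices `0, …, k-1`). -/
def UsesVars {σ : Signature} (k : ℕ) (φ : Fml σ) : Prop :=
  ∀ i ∈ φ.vars, i < k

/-- A sentence is a formula with no free variables. -/
def IsSentence {σ : Signature} (φ : Fml σ) : Prop := φ.freeVars = ∅

/-- Satisfaction of a sentence (assignment-independent for sentences over
nonempty structures). -/
def SatS {σ : Signature} (M : Struct σ) (φ : Fml σ) : Prop :=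
  ∀ f : ℕ → M.carrier, Fml.Sat M f φ

/-- `φ` distinguishes `A` from `B`: `A ⊨ φ` and `B ⊭ φ`. -/
def Distinguishes {σ : Signature} (A B : Struct σ) (φ : Fml σ) : Prop :=
  SatS A φ ∧ ¬ SatS B φ

/-- `A` and `B` agree on `φ`. -/
def AgreeOn {σ : Signature} (A B : Struct σ) (φ : Fml σ) : Prop :=
  SatS A φ ↔ SatS B φ

/-- A pebbled structure: a structure together with a partial assignment of the
variables to elements. -/
structure Pebbled (σ : Signature) : Type 1 where
  M : Struct σ
  α : ℕ → Option M.carrier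

/-- The domain of the partial assignment of a pebbled structure. -/
def Pebbled.dom {σ : Signature} (P : Pebbled σ) : Set ℕ := {i | P.α i ≠ none}

/-- A `k`-pebbled structure: only the variables `x_1, …, x_k` may be assigned. -/
def Pebbled.IsK {σ : Signature} (k : ℕ) (P : Pebbled σ) : Prop :=
  ∀ i, k ≤ i → P.α i = none

/-- Satisfaction for pebbled structures: `φ` holds under every total extension of
the partial assignment. -/
def PSat {σ : Signature} (P : Pebbled σ) (φ : Fml σ) : Prop :=
  ∀ f : ℕ → P.M.carrier, (∀ i a, P.α i = some a → f i = a) → Fml.Sat P.M f φ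

/-- Two sets of pebbled structures disagree on `φ`: every member of `𝔄`
satisfies `φ` and no member of `𝔅` does. -/
def DisagreeOn {σ : Signature} (𝔄 𝔅 : Set (Pebbled σ)) (φ : Fml σ) : Prop :=
  (∀ P ∈ 𝔄, PSat P φ) ∧ (∀ P ∈ 𝔅, ¬ PSat P φ)

/-- A constraint over variables `V` and group `G`: a tuple of variables together
with a subset `H ⊆ G`. -/
structure Constraint (V G : Type) : Type where
  vars : List V
  H : Set G

/-- A (total) assignment satisfies a constraint if the sum of the values of its
variables lies in `H`. -/
def Constraint.SatBy {V G : Type} [AddCommMonoid G] (C : Constraint V G) (f : V → G) : Prop :=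
  (C.vars.map f).sum ∈ C.H

/-- A partial assignment (a function `f` regarded on the domain `X`) violates no
constraint of `F`: every constraint of `F` all of whose variables lie in `X` is
satisfied. -/
def ViolatesNoClause {V G : Type} [AddCommMonoid G]
    (F : Finset (Constraint V G)) (X : Set V) (f : V → G) : Prop :=
  ∀ C ∈ F, (∀ x ∈ C.vars, x ∈ X) → C.SatBy f

/-- The set of the constraint `C` in `F̂`: its complement if `C` is
distinguishing (i.e. `C ∈ D`), and `C.H` otherwise. -/
def hatH {V G : Type} (D : Set (Constraint V G)) (C : Constraint V G) : Set G :=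
  {g | (C ∈ D → g ∉ C.H) ∧ (C ∉ D → g ∈ C.H)}

/-- `F` (with distinguishing constraints `D`) is a formula over `G` using at most
`k`-ary clauses: each clause is a nonrepeating tuple of at most `k` variables, and
each set appearing in `F̂` is a subgroup of index two. -/
def IsXorFormula {V G : Type} [AddCommGroup G] (k : ℕ)
    (F : Finset (Constraint V G)) (D : Set (Constraint V G)) : Prop :=
  (∀ C ∈ D, C ∈ F) ∧
  ∀ C ∈ F, C.vars.Nodup ∧ C.vars.length ≤ k ∧
    ∃ H' : AddSubgroup G, hatH D C = ↑H' ∧ H'.index = 2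

/-- The common signature of the structures `𝒜(F)` and `ℬ(F)`: a unary relation
symbol `R_x` for each variable `x` and an `m`-ary relation symbol `R_C` for each
constraint `C ∈ F` on `m` variables. -/
@[reducible] def xorSig (V G : Type) [Fintype V] [Fintype G]
    (F : Finset (Constraint V G)) : Signature where
  symbols := V ⊕ {C : Constraint V G // C ∈ F}
  fin := inferInstance
  arity := fun s => match s with
    | Sum.inl _ => 1
    | Sum.inr C => C.1.vars.length

/-- The structure with domain `V × G` (the element `x^g` is the pair `(x,g)`),
where the relation of the constraint `C` is interpreted using the set `Hf C`. -/
@[reducible] def mkXorStruct (V G : Type) [Fintype V] [Fintype G] [AddCommMonoid G]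
    (F : Finset (Constraint V G)) (Hf : Constraint V G → Set G) :
    Struct (xorSig V G F) where
  carrier := V × G
  rel := fun R => match R with
    | Sum.inl x => fun t => (t 0).1 = x
    | Sum.inr C => fun t => (∀ i, (t i).1 = C.1.vars.get i) ∧ (∑ i, (t i).2) ∈ Hf C.1

/-- The structure `𝒜(F) = X(F̂)` (with relations renamed to the common signature). -/
@[reducible] def Astruct (V G : Type) [Fintype V] [Fintype G] [AddCommMonoid G]
    (F : Finset (Constraint V G)) (D : Set (Constraint V G)) : Struct (xorSig V G F) :=
  mkXorStruct V G F (hatH D)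

/-- The structure `ℬ(F) = X(F)`. -/
@[reducible] def Bstruct (V G : Type) [Fintype V] [Fintype G] [AddCommMonoid G]
    (F : Finset (Constraint V G)) : Struct (xorSig V G F) :=
  mkXorStruct V G F (fun C => C.H)

/-- An isomorphism between two structures over a common signature: a bijection of
the domains preserving all relations in both directions. -/
def Isomorphic {σ : Signature} (A B : Struct σ) : Prop :=
  ∃ e : A.carrier ≃ B.carrier,
    ∀ (R : σ.symbols) (t : Fin (σ.arity R) → A.carrier),
      A.rel R t ↔ B.rel R (fun i => e (t i))

/-- `m : Y → B(F)` (with `Y ⊆ A(F) = V × G`) is assignment defining: it respects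
the first (variable) component, and `|m y| + |y|` depends only on `π y`. -/
def AssignDefining {V G : Type} [AddCommMonoid G] (Y : Set (V × G)) (m : Y → V × G) : Prop :=
  (∀ y : Y, (m y).1 = (y : V × G).1) ∧
  ∀ y z : Y, (y : V × G).1 = (z : V × G).1 →
    (m y).2 + (y : V × G).2 = (m z).2 + (z : V × G).2

/-- `m : Y → B.carrier` (with `Y ⊆ A.carrier`) is a partial isomorphism: it is
injective and preserves all relations in both directions. -/
def PartialIsoMap {σ : Signature} (A B : Struct σ) (Y : Set A.carrier)
    (m : Y → B.carrier) : Prop :=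
  Function.Injective m ∧
  ∀ (R : σ.symbols) (t : Fin (σ.arity R) → Y),
    A.rel R (fun i => (t i : A.carrier)) ↔ B.rel R (fun i => m (t i))

/-- The group `Z_2^k`. -/
abbrev Gk (k : ℕ) : Type := Fin k → ZMod 2

/-- The variable set `V = {s_1, …, s_k, e_1, …, e_k}`: `Sum.inl i` is `s_{i+1}`
and `Sum.inr ℓ` is `e_{ℓ+1}`. -/
abbrev Vk (k : ℕ) : Type := Fin k ⊕ Fin k

/-- The elements of `Z_2^k` whose coordinates sum to `0`. -/
def EVEN (k : ℕ) : Set (Gk k) := {g | ∑ i, g i = 0}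

/-- The elements of `Z_2^k` whose coordinates sum to `1`. -/
def ODD (k : ℕ) : Set (Gk k) := {g | ∑ i, g i = 1}

open scoped Classical in
/-- The formula `F` over `Z_2^k` from Section 5: clauses `s_1 ∈ ODD`;
`s_i ∈ EVEN` for `i ≠ 1`; `(e_ℓ + Σ_{i≠ℓ} s_i)[ℓ] = 0`; `s_i[i] = 0`;
`e_ℓ[i] = 0`. -/
noncomputable def baseF (k : ℕ) (hk : 0 < k) : Finset (Constraint (Vk k) (Gk k)) :=
  {⟨[Sum.inl ⟨0, hk⟩], ODD k⟩}
  ∪ (Finset.univ.filter (fun i : Fin k => i ≠ ⟨0, hk⟩)).image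
      (fun i : Fin k => ⟨[Sum.inl i], EVEN k⟩)
  ∪ Finset.univ.image (fun ℓ : Fin k =>
      ⟨Sum.inr ℓ :: (Finset.univ.erase ℓ).toList.map Sum.inl, {g : Gk k | g ℓ = 0}⟩)
  ∪ Finset.univ.image (fun i : Fin k => ⟨[Sum.inl i], {g : Gk k | g i = 0}⟩)
  ∪ Finset.univ.image (fun p : Fin k × Fin k => ⟨[Sum.inr p.1], {g : Gk k | g p.2 = 0}⟩)

/-- The set of distinguishing clauses of `baseF`: just `s_1 ∈ ODD`. -/
def baseD (k : ℕ) (hk : 0 < k) : Set (Constraint (Vk k) (Gk k)) :=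
  {⟨[Sum.inl ⟨0, hk⟩], ODD k⟩}

/-- `j+1` as an element of `Fin n` (junk value `j` if `j` is the last index). -/
def succIdx {n : ℕ} (j : Fin n) : Fin n := if h : j.1 + 1 < n then ⟨j.1 + 1, h⟩ else j

open scoped Classical in
/-- The chained formula `𝓕` with `n` links: the variable `x(i)` is the pair
`(i, x)`.  It consists of the clauses of the `n` copies of `baseF`, except that
`s_1(i) ∈ ODD` is kept only for `i = 1` and `e_ℓ(i)[ℓ] = 0` only for `i = n`,
together with the linking clauses `e_ℓ(i) + s_1(i+1) ∈ EVEN` for `i ∈ [n-1]`. -/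
noncomputable def chainF (k n : ℕ) (hk : 0 < k) (hn : 0 < n) :
    Finset (Constraint (Fin n × Vk k) (Gk k)) :=
  {⟨[((⟨0, hn⟩ : Fin n), Sum.inl ⟨0, hk⟩)], ODD k⟩}
  ∪ (Finset.univ.filter (fun p : Fin n × Fin k => p.2 ≠ ⟨0, hk⟩)).image
      (fun p : Fin n × Fin k => ⟨[(p.1, Sum.inl p.2)], EVEN k⟩)
  ∪ Finset.univ.image (fun p : Fin n × Fin k =>
      ⟨(p.1, Sum.inr p.2) ::
          (Finset.univ.erase p.2).toList.map (fun i : Fin k => (p.1, Sum.inl i)),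
        {g : Gk k | g p.2 = 0}⟩)
  ∪ Finset.univ.image (fun p : Fin n × Fin k =>
      ⟨[(p.1, Sum.inl p.2)], {g : Gk k | g p.2 = 0}⟩)
  ∪ ((Finset.univ : Finset (Fin n × Fin k × Fin k)).filter
        (fun p => p.2.2 ≠ p.2.1 ∨ p.1 = (⟨n - 1, by omega⟩ : Fin n))).image
      (fun p : Fin n × Fin k × Fin k =>
        ⟨[(p.1, Sum.inr p.2.1)], {g : Gk k | g p.2.2 = 0}⟩)
  ∪ ((Finset.univ : Finset (Fin n × Fin k)).filter (fun p => p.1.1 + 1 < n)).image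
      (fun p : Fin n × Fin k =>
        ⟨[(p.1, Sum.inr p.2), (succIdx p.1, Sum.inl ⟨0, hk⟩)], EVEN k⟩)

/-- The set of distinguishing clauses of `chainF`: just `s_1(1) ∈ ODD`. -/
def chainD (k n : ℕ) (hk : 0 < k) (hn : 0 < n) : Set (Constraint (Fin n × Vk k) (Gk k)) :=
  {⟨[((⟨0, hn⟩ : Fin n), Sum.inl ⟨0, hk⟩)], ODD k⟩}

/-! ### Proof -/

theorem sat_congr {σ : Signature} (M : Struct σ) (φ : Fml σ) :
    ∀ f g : ℕ → M.carrier, (∀ i ∈ φ.freeVars, f i = g i) →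
      (Fml.Sat M f φ ↔ Fml.Sat M g φ) := by
  induction φ with
  | eq i j =>
    intro f g h
    simp only [Fml.Sat]
    rw [h i (by simp [Fml.freeVars]), h j (by simp [Fml.freeVars])]
  | rel R v =>
    intro f g h
    simp only [Fml.Sat]
    have : (fun m => f (v m)) = fun m => g (v m) := by
      funext m
      exact h _ (by simp [Fml.freeVars])
    rw [this]
  | not φ ih =>
    intro f g h
    simp only [Fml.Sat]
    rw [ih f g h]
  | and φ ψ ih1 ih2 =>
    intro f g h
    simp only [Fml.Sat]
    rw [ih1 f g (fun i hi => h i (by simp [Fml.freeVars, hi])),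
      ih2 f g (fun i hi => h i (by simp [Fml.freeVars, hi]))]
  | or φ ψ ih1 ih2 =>
    intro f g h
    simp only [Fml.Sat]
    rw [ih1 f g (fun i hi => h i (by simp [Fml.freeVars, hi])),
      ih2 f g (fun i hi => h i (by simp [Fml.freeVars, hi]))]
  | ex j φ ih =>
    intro f g h
    simp only [Fml.Sat]
    refine exists_congr fun a => ih _ _ fun i hi => ?_
    by_cases hij : i = j
    · subst hij; simp
    · simp only [Function.update_of_ne hij]
      exact h i (by simp [Fml.freeVars, hi, hij])
  | all j φ ih =>
    intro f g h
    simp only [Fml.Sat]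
    refine forall_congr' fun a => ih _ _ fun i hi => ?_
    by_cases hij : i = j
    · subst hij; simp
    · simp only [Function.update_of_ne hij]
      exact h i (by simp [Fml.freeVars, hi, hij])

/-- `f` is a level-`i` assignment whose only violated clause is the `ℓ`-th sum clause of link `i`. -/
structure Lvl {k n : ℕ} (hk : 0 < k) (f : Fin n × Vk k → Gk k) (i : Fin n) (l : Fin k) : Prop where
  diag : ∀ i' m, f (i', Sum.inl m) m = 0
  par : ∀ i' m, ∑ c, f (i', Sum.inl m) c = if m = ⟨0, hk⟩ ∧ i'.1 ≤ i.1 then 1 else 0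
  e : ∀ i' m, f (i', Sum.inr m) = if i'.1 < i.1 then Pi.single m 1 else 0
  sum : ∀ i' c, ∑ m, f (i', Sum.inl m) c = if i'.1 < i.1 ∨ (i' = i ∧ c = l) then 1 else 0

theorem zmod2_add_self (a : ZMod 2) : a + a = 0 := by
  revert a; decide

theorem Lvl.shift {k n : ℕ} {hk : 0 < k} {f : Fin n × Vk k → Gk k} {i : Fin n} {l : Fin k}
    (h : Lvl hk f i l) {m l' : Fin k} (hl : l ≠ m) (hl' : l' ≠ m) :
    ∃ f' : Fin n × Vk k → Gk k, Lvl hk f' i l' ∧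
      ∀ x, x ≠ (i, Sum.inl m) → f' x = f x := by
  classical
  refine ⟨Function.update f (i, Sum.inl m)
    (f (i, Sum.inl m) + (Pi.single l 1 + Pi.single l' 1)), ?_, ?_⟩
  · refine ⟨?_, ?_, ?_, ?_⟩
    · intro i' m'
      by_cases hx : (i', (Sum.inl m' : Vk k)) = (i, Sum.inl m)
      · rw [hx]
        simp only [Prod.mk.injEq, Sum.inl.injEq] at hx
        obtain ⟨rfl, rfl⟩ := hx
        simp [h.diag, hl.symm, hl'.symm]
      · rw [Function.update_of_ne hx]; exact h.diag _ _
    · intro i' m'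
      by_cases hx : (i', (Sum.inl m' : Vk k)) = (i, Sum.inl m)
      · rw [hx]
        simp only [Prod.mk.injEq, Sum.inl.injEq] at hx
        obtain ⟨rfl, rfl⟩ := hx
        simp only [Function.update_self, Pi.add_apply, Finset.sum_add_distrib, h.par]
        simp [zmod2_add_self]
      · rw [Function.update_of_ne hx]; exact h.par _ _
    · intro i' m'
      rw [Function.update_of_ne (by simp)]; exact h.e _ _
    · intro i' c
      by_cases hi : i' = i
      · subst hi
        have : ∀ m', Function.update f (i', Sum.inl m)
            (f (i', Sum.inl m) + (Pi.single l 1 + Pi.single l' 1)) (i', Sum.inl m') c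
            = f (i', Sum.inl m') c + if m' = m then
              ((Pi.single l 1 + Pi.single l' 1 : Gk k) c) else 0 := by
          intro m'
          by_cases hm : m' = m
          · subst hm; simp
          · rw [Function.update_of_ne (by simpa using hm)]; simp [hm]
        simp only [this, Finset.sum_add_distrib, h.sum]
        simp only [Pi.add_apply, Pi.single_apply, lt_irrefl, true_and, false_or,
          Finset.sum_ite_eq', Finset.mem_univ, if_true]
        rw [← add_assoc, zmod2_add_self, zero_add]
      · have : ∀ m', Function.update f (i, Sum.inl m)
            (f (i, Sum.inl m) + (Pi.single l 1 + Pi.single l' 1)) (i', Sum.inl m') 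
            = f (i', Sum.inl m') := by
          intro m'
          rw [Function.update_of_ne (by simp [hi])]
        simp only [this, h.sum, hi, false_and]
  · intro x hx
    rw [Function.update_of_ne hx]

/-- The assignment one level up. -/
def nextF {k n : ℕ} (hk : 0 < k) (hk3 : 3 ≤ k) (f : Fin n × Vk k → Gk k) (i : Fin n) (l : Fin k) :
    Fin n × Vk k → Gk k
  | (i', Sum.inl m) =>
      if i'.1 < i.1 then f (i', Sum.inl m)
      else if i' = i then
        f (i', Sum.inl m) + if m = l then ((fun _ => 1 : Gk k) + (Pi.single l 1 : Gk k)) else 0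
      else if i'.1 = i.1 + 1 ∧ m = ⟨0, hk⟩ then (Pi.single ⟨1, by omega⟩ 1 : Gk k) else 0
  | (i', Sum.inr m) => if i'.1 < i.1 + 1 then (Pi.single m 1 : Gk k) else 0

/-- The link-`i` start assignment, below given data. -/
theorem Lvl.next {k n : ℕ} {hk : 0 < k} (hk3 : 3 ≤ k) (hodd : Odd k)
    {f : Fin n × Vk k → Gk k} {i : Fin n} {l : Fin k}
    (h : Lvl hk f i l) (hi : i.1 + 1 < n) :
    ∃ f' : Fin n × Vk k → Gk k, Lvl hk f' ⟨i.1 + 1, hi⟩ ⟨1, by omega⟩ ∧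
      ∀ m, m ≠ l → f' (i, Sum.inl m) = f (i, Sum.inl m) := by
  have hk2 : ((k : ℕ) : ZMod 2) = 1 := by
    obtain ⟨r, rfl⟩ := hodd
    push_cast
    rw [show (2 : ZMod 2) = 0 from rfl]; simp
  refine ⟨nextF hk hk3 f i l, ⟨?_, ?_, ?_, ?_⟩, ?_⟩
  · intro i' m
    simp only [nextF]
    split_ifs with h1 h2 h3 h4
    · exact h.diag _ _
    · subst h3; simp [h.diag, zmod2_add_self]
    · simp [h.diag]
    · rw [h4.2]; simp
    · rfl
  · intro i' m
    simp only [nextF]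
    by_cases h1 : i'.1 < i.1
    · simp only [h1, if_true, h.par]
      have a1 : i'.1 ≤ i.1 := by omega
      have a2 : i'.1 ≤ i.1 + 1 := by omega
      simp [a1, a2]
    · by_cases h2 : i' = i
      · subst h2
        simp only [lt_irrefl, if_false, if_true, Pi.add_apply, Finset.sum_add_distrib, h.par]
        by_cases h3 : m = l
        · subst h3
          simp [Finset.sum_add_distrib, hk2, zmod2_add_self]
        · simp [h3]
      · have h2' : i'.1 ≠ i.1 := fun e => h2 (Fin.ext e)
        by_cases h3 : i'.1 = i.1 + 1
        · by_cases h4 : m = ⟨0, hk⟩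
          · simp [h2, h3, h4]
          · simp [h2, h3, h4]
        · have h5 : ¬ i'.1 ≤ i.1 + 1 := by omega
          simp [h1, h2, h3, h5]
  · intro i' m
    rfl
  · intro i' c
    simp only [nextF]
    by_cases h1 : i'.1 < i.1
    · simp only [h1, if_true, h.sum]
      simp [show i'.1 < i.1 + 1 by omega]
    · by_cases h2 : i' = i
      · subst h2
        simp only [lt_irrefl, if_false, if_true, Pi.add_apply, Finset.sum_add_distrib, h.sum]
        have : ∀ x : Fin k, (if x = l then ((fun _ => 1 : Gk k) + Pi.single l 1 : Gk k) else 0) c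
            = if x = l then (1 + (Pi.single l 1 : Gk k) c) else 0 := by
          intro x; split_ifs <;> simp
        simp only [this]
        simp only [Pi.single_apply, Finset.sum_ite_eq', Finset.mem_univ, if_true]
        by_cases hc : c = l
        · simp [hc, zmod2_add_self]
        · simp [hc]
      · have h2' : i'.1 ≠ i.1 := fun e => h2 (Fin.ext e)
        have h3' : ¬ i'.1 < i.1 + 1 := by omega
        by_cases h3 : i'.1 = i.1 + 1
        · have h4 : i' = ⟨i.1 + 1, hi⟩ := Fin.ext h3
          simp only [h1, h2, h3, if_false, true_and]
          simp [h4, ite_apply, Pi.single_apply]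
        · have h4 : i' ≠ ⟨i.1 + 1, hi⟩ := fun e => h3 (by rw [e])
          simp [h1, h2, h3, h3', h4]
  · intro m hm
    simp [nextF, hm]

theorem Lvl.start {k n : ℕ} (hk : 0 < k) (hk3 : 3 ≤ k) (hn : 0 < n) :
    Lvl hk (fun x : Fin n × Vk k => if x = (⟨0, hn⟩, Sum.inl ⟨0, hk⟩) then
      (Pi.single ⟨1, by omega⟩ 1 : Gk k) else 0) ⟨0, hn⟩ ⟨1, by omega⟩ := by
  classical
  refine ⟨?_, ?_, ?_, ?_⟩
  · intro i' m
    by_cases h1 : i' = ⟨0, hn⟩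
    · by_cases h2 : m = ⟨0, hk⟩ <;> simp [h1, h2]
    · simp [h1]
  · intro i' m
    have e : i'.1 = 0 ↔ i' = ⟨0, hn⟩ := ⟨fun e => Fin.ext e, fun e => by rw [e]⟩
    by_cases h1 : i' = ⟨0, hn⟩
    · by_cases h2 : m = ⟨0, hk⟩ <;> simp [h1, h2]
    · simp [h1, e]
  · intro i' m
    simp
  · intro i' c
    by_cases h1 : i' = ⟨0, hn⟩
    · have : ∀ x : Fin k, (if x = ⟨0, hk⟩ then
              (Pi.single ⟨1, by omega⟩ 1 : Gk k) else 0) c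
            = if x = ⟨0, hk⟩ then ((Pi.single ⟨1, by omega⟩ 1 : Gk k) c) else 0 := by
        intro x; split_ifs <;> simp
      simp [h1, this, Pi.single_apply]
    · simp [h1]

/-- Every clause of the chained formula, other than the violated one, relates the two structures
properly under the shift by `f`. -/
theorem Lvl.clause {k n : ℕ} {hk : 0 < k} {hn : 0 < n}
    {f : Fin n × Vk k → Gk k} {i : Fin n} {l : Fin k} (h : Lvl hk f i l)
    (C : Constraint (Fin n × Vk k) (Gk k)) (hC : C ∈ chainF k n hk hn)
    (hcov : ¬ ((i, Sum.inr l) ∈ C.vars ∧ ∀ m, m ≠ l → (i, Sum.inl m) ∈ C.vars)) (g : Gk k) :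
    g ∈ hatH (chainD k n hk hn) C ↔ g + (C.vars.map f).sum ∈ C.H := by
  classical
  have key : ∀ (χ : Gk k →+ ZMod 2), C.H = {g | χ g = 0} → χ (C.vars.map f).sum = 0 →
      (g ∈ hatH (chainD k n hk hn) C ↔ g + (C.vars.map f).sum ∈ C.H) := by
    intro χ h1 h2
    have h3 : C ∉ chainD k n hk hn := by
      intro h3
      have h4 : C.H = ODD k := by rw [Set.mem_singleton_iff.1 h3]
      have h5 : (0 : Gk k) ∈ C.H := by rw [h1]; simp
      rw [h4] at h5
      simp [ODD] at h5
    simp only [hatH, h3, Set.mem_ofPred_eq, h1, map_add, h2, add_zero]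
    simp
  let χs : Gk k →+ ZMod 2 := ∑ c, Pi.evalAddMonoidHom (fun _ : Fin k => ZMod 2) c
  have hχs : ∀ g, χs g = ∑ c, g c := fun g => by simp [χs]
  have hE : EVEN k = {g | χs g = 0} := by ext g; simp [EVEN, hχs]
  simp only [chainF, Finset.mem_union, Finset.mem_singleton, Finset.mem_image,
    Finset.mem_filter, Finset.mem_univ, true_and] at hC
  rcases hC with ((((hC | ⟨p, hp, hC⟩) | ⟨p, hC⟩) | ⟨p, hC⟩) | ⟨p, hp, hC⟩) | ⟨p, hp, hC⟩
  · subst hC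
    have h3 := h.par ⟨0, hn⟩ ⟨0, hk⟩
    simp only [hatH, chainD, Set.mem_singleton_iff, ODD, Set.mem_ofPred_eq, List.map_cons,
      List.map_nil, List.sum_cons, List.sum_nil, add_zero, Pi.add_apply, Finset.sum_add_distrib, h3]
    generalize ∑ c, g c = a
    revert a
    simp
    decide
  · subst hC
    refine key χs hE ?_
    simp [hχs, h.par, hp]
  · refine key (Pi.evalAddMonoidHom (fun _ : Fin k => ZMod 2) p.2) (by rw [← hC]; rfl) ?_
    have hne : ¬ (p.1 = i ∧ p.2 = l) := by
      rintro ⟨rfl, rfl⟩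
      apply hcov
      rw [← hC]
      refine ⟨by simp, fun m hm => ?_⟩
      simp [hm]
    have h1 := h.sum p.1 p.2
    rw [← Finset.add_sum_erase _ _ (Finset.mem_univ p.2), h.diag, zero_add] at h1
    rw [← hC]
    have h2 : (List.map f (List.map (fun i : Fin k => (p.1, (Sum.inl i : Vk k)))
        (Finset.univ.erase p.2).toList)).sum = ∑ m ∈ Finset.univ.erase p.2, f (p.1, Sum.inl m) := by
      rw [List.map_map, ← Finset.sum_map_toList]; rfl
    simp only [List.map_cons, List.sum_cons, h2, map_add, Pi.evalAddMonoidHom_apply,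
      Finset.sum_apply, h1, h.e]
    simp only [hne, or_false]
    split_ifs
    · simp [zmod2_add_self]
    · simp
  · subst hC
    refine key (Pi.evalAddMonoidHom (fun _ : Fin k => ZMod 2) p.2) rfl ?_
    simp [h.diag]
  · subst hC
    refine key (Pi.evalAddMonoidHom (fun _ : Fin k => ZMod 2) p.2.2) rfl ?_
    simp only [List.map_cons, List.map_nil, List.sum_cons, List.sum_nil, add_zero,
      Pi.evalAddMonoidHom_apply, h.e]
    split_ifs with h1
    · rcases hp with hp | hp
      · simp [hp]
      · have := i.2
        rw [hp] at h1
        simp only at h1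
        omega
    · rfl
  · subst hC
    refine key χs hE ?_
    have hs : (succIdx p.1).1 = p.1.1 + 1 := by simp [succIdx, hp]
    simp only [List.map_cons, List.map_nil, List.sum_cons, List.sum_nil, add_zero,
      map_add, h.e]
    rw [hχs, hχs, h.par, hs]
    simp only [true_and]
    by_cases h1 : p.1.1 < i.1
    · have h2 : p.1.1 + 1 ≤ i.1 := h1
      simp [h1, h2, zmod2_add_self]
    · have h2 : ¬ p.1.1 + 1 ≤ i.1 := h1
      simp [h1, h2]

/-- The formula `ψ` tells `(A, α)` and `(B, β)` apart. -/
def Dist {σ : Signature} (A B : Struct σ) (ψ : Fml σ) (α : ℕ → A.carrier) (β : ℕ → B.carrier) :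
    Prop := ¬ (Fml.Sat A α ψ ↔ Fml.Sat B β ψ)

section game

variable {k n : ℕ} (hk : 0 < k) (hn : 0 < n)

/-- the structure `𝒞` -/
noncomputable abbrev SA : Struct (xorSig (Fin n × Vk k) (Gk k) (chainF k n hk hn)) :=
  Astruct (Fin n × Vk k) (Gk k) (chainF k n hk hn) (chainD k n hk hn)

/-- the structure `𝒟` -/
noncomputable abbrev SB : Struct (xorSig (Fin n × Vk k) (Gk k) (chainF k n hk hn)) :=
  Bstruct (Fin n × Vk k) (Gk k) (chainF k n hk hn)

/-- pebble `j` is compatible with the shift `f`. -/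
def Compat (f : Fin n × Vk k → Gk k) (a b : (Fin n × Vk k) × Gk k) : Prop :=
  b.1 = a.1 ∧ b.2 = a.2 + f a.1

/-- Non-full position at level `i`. -/
def NF (i : Fin n) (α β : ℕ → (Fin n × Vk k) × Gk k) : Prop :=
  ∃ f l m, Lvl hk f i l ∧ (∀ j < k, Compat f (α j) (β j)) ∧ m ≠ l ∧
    ∀ j < k, (α j).1 ≠ (i, Sum.inl m)

/-- Full position at level `i`, where pebble `j` has to be moved. -/
def Full (i : Fin n) (j : ℕ) (α β : ℕ → (Fin n × Vk k) × Gk k) : Prop :=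
  ∃ f l, Lvl hk f i l ∧ (∀ j < k, Compat f (α j) (β j)) ∧ j < k ∧ (α j).1 = (i, Sum.inl l) ∧
    ∀ m, ∃ j' < k, (α j').1 = (i, Sum.inl m)

/-- In a full position every pebble lies on a distinct `s`. -/
theorem full_inj {i : Fin n} {α : ℕ → (Fin n × Vk k) × Gk k}
    (h : ∀ m : Fin k, ∃ j' < k, (α j').1 = (i, Sum.inl m)) :
    (∀ j < k, ∃ m : Fin k, (α j).1 = (i, Sum.inl m)) ∧
    ∀ j < k, ∀ j' < k, (α j).1 = (α j').1 → j = j' := by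
  choose c hc1 hc2 using h
  let c' : Fin k → Fin k := fun m => ⟨c m, hc1 m⟩
  have hinj : Function.Injective c' := by
    intro m m' hm
    have h1 : c m = c m' := congrArg Fin.val hm
    have h2 := hc2 m
    rw [h1, hc2 m'] at h2
    simpa using h2.symm
  have hsur := Finite.surjective_of_injective hinj
  have hex : ∀ j < k, ∃ m : Fin k, c m = j := by
    intro j hj
    obtain ⟨m, hm⟩ := hsur ⟨j, hj⟩
    exact ⟨m, congrArg Fin.val hm⟩
  constructor
  · intro j hj
    obtain ⟨m, rfl⟩ := hex j hj
    exact ⟨m, hc2 m⟩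
  · intro j hj j' hj' he
    obtain ⟨m, rfl⟩ := hex j hj
    obtain ⟨m', rfl⟩ := hex j' hj'
    rw [hc2, hc2] at he
    simp only [Prod.mk.injEq, Sum.inl.injEq, true_and] at he
    rw [he]

/-- Atomic formulas do not distinguish positions which do not cover the violated clause. -/
theorem atom_eq {f : Fin n × Vk k → Gk k} {α β : ℕ → (Fin n × Vk k) × Gk k}
    (hc : ∀ j < k, Compat f (α j) (β j)) {a b : ℕ} (ha : a < k) (hb : b < k) :
    ¬ Dist (SA hk hn) (SB hk hn) (.eq a b) α β := by
  unfold Dist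
  rw [not_not]
  simp only [Fml.Sat]
  obtain ⟨h1, h2⟩ := hc a ha
  obtain ⟨h3, h4⟩ := hc b hb
  constructor
  · intro h
    rw [Prod.ext_iff, h1, h2, h3, h4, h]
    simp
  · intro h
    have e1 : (α a).1 = (α b).1 := by rw [← h1, ← h3, h]
    refine Prod.ext e1 ?_
    have e2 : (β a).2 = (β b).2 := by rw [h]
    rw [h2, h4, e1] at e2
    exact add_right_cancel e2

theorem atom_rel {f : Fin n × Vk k → Gk k} {α β : ℕ → (Fin n × Vk k) × Gk k} {i l}
    (hl : Lvl hk f i l)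
    (hc : ∀ j < k, Compat f (α j) (β j))
    (hcov : ¬ ((∃ j < k, (α j).1 = (i, Sum.inr l)) ∧
      ∀ m, m ≠ l → ∃ j < k, (α j).1 = (i, Sum.inl m)))
    (R : (xorSig (Fin n × Vk k) (Gk k) (chainF k n hk hn)).symbols) (v)
    (hv : ∀ a, v a < k) :
    ¬ Dist (SA hk hn) (SB hk hn) (.rel R v) α β := by
  unfold Dist
  rw [not_not]
  simp only [Fml.Sat]
  rcases R with x | ⟨C, hC⟩
  · show (α (v 0)).1 = x ↔ (β (v 0)).1 = x
    rw [(hc _ (hv 0)).1]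
  · show ((∀ a, (α (v a)).1 = C.vars.get a) ∧ (∑ a, (α (v a)).2) ∈ hatH _ C) ↔
      ((∀ a, (β (v a)).1 = C.vars.get a) ∧ (∑ a, (β (v a)).2) ∈ C.H)
    have e1 : ∀ a, (β (v a)).1 = (α (v a)).1 := fun a => (hc _ (hv a)).1
    simp only [e1]
    refine and_congr_right fun h1 => ?_
    have e2 : ∀ a, (β (v a)).2 = (α (v a)).2 + f (C.vars.get a) := fun a => by
      rw [(hc _ (hv a)).2, h1 a]
    simp only [e2, Finset.sum_add_distrib]
    have e3 : ∑ a, f (C.vars.get a) = (C.vars.map f).sum := by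
      rw [← List.sum_ofFn]
      congr 1
      apply List.ext_get <;> simp
    have hcv : ∀ x ∈ C.vars, ∃ j < k, (α j).1 = x := by
      intro x hx
      obtain ⟨a, ha⟩ := List.get_of_mem hx
      exact ⟨v a, hv a, by rw [h1 a, ha]⟩
    have := hl.clause C hC (fun h => hcov ⟨hcv _ h.1, fun m hm => hcv _ (h.2 m hm)⟩)
      (∑ a, (α (v a)).2)
    rw [this]
    exact iff_of_eq (by rw [← e3])

theorem NF.cov {i : Fin n} {α : ℕ → (Fin n × Vk k) × Gk k} {l m : Fin k} (hm : m ≠ l)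
    (h : ∀ j < k, (α j).1 ≠ (i, Sum.inl m)) :
    ¬ ((∃ j < k, (α j).1 = (i, Sum.inr l)) ∧
      ∀ m, m ≠ l → ∃ j < k, (α j).1 = (i, Sum.inl m)) := by
  rintro ⟨-, h2⟩
  obtain ⟨j, hj, hj'⟩ := h2 m hm
  exact h j hj hj'

theorem Full.cov {i : Fin n} {α : ℕ → (Fin n × Vk k) × Gk k} {l : Fin k}
    (h : ∀ m : Fin k, ∃ j' < k, (α j').1 = (i, Sum.inl m)) :
    ¬ ((∃ j < k, (α j).1 = (i, Sum.inr l)) ∧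
      ∀ m, m ≠ l → ∃ j < k, (α j).1 = (i, Sum.inl m)) := by
  rintro ⟨⟨j, hj, hj'⟩, -⟩
  obtain ⟨m, hm⟩ := (full_inj h).1 j hj
  rw [hj'] at hm
  simp at hm

/-- Spoiler's move: he picks a variable `x`; every reply of Duplicator is again distinguished. -/
theorem move_ex {j : ℕ} {ψ} {α β : ℕ → (Fin n × Vk k) × Gk k}
    (h : Dist (SA hk hn) (SB hk hn) (.ex j ψ) α β) :
    ∃ x : Fin n × Vk k, ∀ f : Fin n × Vk k → Gk k, ∃ a b, a.1 = x ∧ Compat f a b ∧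
      Dist (SA hk hn) (SB hk hn) ψ (Function.update α j a) (Function.update β j b) := by
  unfold Dist at h
  simp only [Fml.Sat] at h
  by_cases hA : ∃ a : (Fin n × Vk k) × Gk k, Fml.Sat (SA hk hn) (Function.update α j a) ψ
  · have hB : ¬ ∃ b : (Fin n × Vk k) × Gk k, Fml.Sat (SB hk hn) (Function.update β j b) ψ :=
      fun hB => h ⟨fun _ => hB, fun _ => hA⟩
    obtain ⟨a, ha⟩ := hA
    refine ⟨a.1, fun f => ⟨a, (a.1, a.2 + f a.1), rfl, ⟨rfl, rfl⟩, fun hh => hB ⟨_, hh.1 ha⟩⟩⟩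
  · have hB : ∃ b : (Fin n × Vk k) × Gk k, Fml.Sat (SB hk hn) (Function.update β j b) ψ := by
      by_contra hB
      exact h ⟨fun h' => (hA h').elim, fun h' => (hB h').elim⟩
    obtain ⟨b, hb⟩ := hB
    refine ⟨b.1, fun f => ⟨(b.1, b.2 - f b.1), b, rfl, ⟨rfl, ?_⟩, fun hh => hA ⟨_, hh.2 hb⟩⟩⟩
    simp

/-- The bound at level `i`. -/
def Bd (k n i : ℕ) : ℕ := (k - 1) ^ (n - i)

/-- The two lower bounds proved simultaneously by induction on formulas. -/
def Good (ψ : Fml (xorSig (Fin n × Vk k) (Gk k) (chainF k n hk hn))) : Prop :=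
  (∀ i α β, NF hk i α β → Dist (SA hk hn) (SB hk hn) ψ α β → Bd k n i.1 + 1 ≤ ψ.quant) ∧
  (∀ (i : Fin n) (S : Finset ℕ), S.card ≤ k - 1 →
    (∀ j ∈ S, ∃ α β, Full hk i j α β ∧ Dist (SA hk hn) (SB hk hn) ψ α β) →
    S.card * Bd k n (i.1 + 1) ≤ ψ.quant)

theorem Bd_succ {i : Fin n} : Bd k n i.1 = (k - 1) * Bd k n (i.1 + 1) := by
  have := i.2
  unfold Bd
  rw [← pow_succ']
  congr 1
  omega

/-- The key step: pebble `j` is lifted, and what remains is non-full at level `i`. -/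
theorem step (hk3 : 3 ≤ k) {ψ} (hG : Good hk hn ψ) {j : ℕ} (hj : j < k) {i : Fin n}
    {α β : ℕ → (Fin n × Vk k) × Gk k} {f l m} (hl : Lvl hk f i l)
    (hc : ∀ j' < k, j' ≠ j → Compat f (α j') (β j')) (hm : m ≠ l)
    (hp : ∀ j' < k, j' ≠ j → (α j').1 ≠ (i, Sum.inl m))
    (hD : Dist (SA hk hn) (SB hk hn) (.ex j ψ) α β) : Bd k n i.1 ≤ ψ.quant := by
  classical
  obtain ⟨x, hx⟩ := move_ex hk hn hD
  have upd : ∀ f' a b, Compat f' a b → (∀ j' < k, j' ≠ j → Compat f' (α j') (β j')) →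
      ∀ j' < k, Compat f' (Function.update α j a j') (Function.update β j b j') := by
    intro f' a b hab h j' hj'
    by_cases e : j' = j
    · subst e; simpa using hab
    · simpa [Function.update_of_ne e] using h j' hj' e
  by_cases hxm : x = (i, Sum.inl m)
  · subst hxm
    have sh : ∀ l', l' ≠ m → ∃ f' : Fin n × Vk k → Gk k, Lvl hk f' i l' ∧
        ∀ j' < k, j' ≠ j → Compat f' (α j') (β j') := by
      intro l' hl'
      obtain ⟨f', h1, h2⟩ := hl.shift hm.symm hl'
      refine ⟨f', h1, fun j' hj' hne => ?_⟩
      obtain ⟨h3, h4⟩ := hc j' hj' hne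
      exact ⟨h3, by rw [h2 _ (hp j' hj' hne)]; exact h4⟩
    by_cases hm' : ∃ m', m' ≠ m ∧ ∀ j' < k, j' ≠ j → (α j').1 ≠ (i, Sum.inl m')
    · obtain ⟨m', hmm, hp'⟩ := hm'
      obtain ⟨l', hl1⟩ : ∃ l' : Fin k, l' ∉ ({m, m'} : Finset (Fin k)) := by
        by_contra hcon
        push Not at hcon
        have h1 : (Finset.univ : Finset (Fin k)) ⊆ {m, m'} := fun x _ => hcon x
        have h2 := Finset.card_le_card h1
        have h3 : ({m, m'} : Finset (Fin k)).card ≤ 2 := Finset.card_le_two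
        simp only [Finset.card_univ, Fintype.card_fin] at h2
        omega
      simp only [Finset.mem_insert, Finset.mem_singleton, not_or] at hl1
      obtain ⟨f', h1, h2⟩ := sh l' hl1.1
      obtain ⟨a, b, ha, hab, hd⟩ := hx f'
      have := hG.1 i _ _ ⟨f', l', m', h1, upd f' a b hab h2, fun e => hl1.2 e.symm, ?_⟩ hd
      · omega
      · intro j' hj'
        by_cases e : j' = j
        · subst e
          simp only [Function.update_self, ha]
          simpa using hmm.symm
        · rw [Function.update_of_ne e]; exact hp' j' hj' e
    · push Not at hm'
      choose! c hc1 hc2 hc3 using hm'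
      have hinj : Set.InjOn c (Finset.univ.erase m : Finset (Fin k)) := by
        intro a ha b hb hab
        simp only [Finset.coe_erase, Finset.coe_univ, Set.mem_sdiff, Set.mem_univ,
          Set.mem_singleton_iff, true_and] at ha hb
        have h1 := hc3 a ha
        rw [hab, hc3 b hb] at h1
        simpa using h1.symm
      have hcard : ((Finset.univ.erase m).image c).card = k - 1 := by
        rw [Finset.card_image_of_injOn hinj]
        simp
      have := hG.2 i ((Finset.univ.erase m).image c) hcard.le ?_
      · rw [hcard] at this
        rwa [Bd_succ]
      · intro j' hj'
        simp only [Finset.mem_image, Finset.mem_erase, Finset.mem_univ, and_true] at hj'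
        obtain ⟨l', hl', rfl⟩ := hj'
        obtain ⟨f', h1, h2⟩ := sh l' hl'
        obtain ⟨a, b, ha, hab, hd⟩ := hx f'
        refine ⟨_, _, ⟨f', l', h1, upd f' a b hab h2, hc1 l' hl', ?_, ?_⟩, hd⟩
        · rw [Function.update_of_ne (hc2 l' hl')]
          exact hc3 l' hl'
        · intro m'
          by_cases e : m' = m
          · subst e
            exact ⟨j, hj, by simp [ha]⟩
          · exact ⟨c m', hc1 m' e, by rw [Function.update_of_ne (hc2 m' e)]; exact hc3 m' e⟩
  · obtain ⟨a, b, ha, hab, hd⟩ := hx f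
    have := hG.1 i _ _ ⟨f, l, m, hl, upd f a b hab hc, hm, ?_⟩ hd
    · omega
    · intro j' hj'
      by_cases e : j' = j
      · subst e
        simpa [ha] using hxm
      · rw [Function.update_of_ne e]; exact hp j' hj' e

theorem good_ex (hk3 : 3 ≤ k) (hodd : Odd k) {ψ} (hG : Good hk hn ψ) {j : ℕ} (hj : j < k) :
    Good hk hn (.ex j ψ) := by
  classical
  constructor
  · rintro i α β ⟨f, l, m, hl, hc, hm, hp⟩ hD
    have := step hk hn hk3 hG hj hl (fun j' hj' _ => hc j' hj') hm (fun j' hj' _ => hp j' hj') hD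
    simpa [Fml.quant] using this
  · intro i S hS hF
    by_cases hex : ∃ j' ∈ S, j' ≠ j
    · obtain ⟨j', hj'S, hne⟩ := hex
      obtain ⟨α, β, ⟨f, l, hl, hc, hj'k, hj'l, hfull⟩, hD⟩ := hF j' hj'S
      obtain ⟨hf1, hf2⟩ := full_inj hfull
      obtain ⟨m, hm⟩ := hf1 j hj
      have := step hk hn hk3 hG hj hl (m := m) (fun j' hj' _ => hc j' hj') ?_ ?_ hD
      · rw [Bd_succ] at this
        have h2 := Nat.mul_le_mul_right (Bd k n (i.1 + 1)) hS
        simp only [Fml.quant]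
        omega
      · rintro rfl
        exact hne (hf2 _ hj'k _ hj (by rw [hj'l, hm]))
      · intro j'' hj'' hne' he
        exact hne' (hf2 _ hj'' _ hj (by rw [he, hm]))
    · push Not at hex
      by_cases hS0 : S = ∅
      · simp [hS0]
      obtain ⟨j', hj'⟩ := Finset.nonempty_iff_ne_empty.2 hS0
      have := hex j' hj'
      subst this
      have hS1 : S.card ≤ 1 := Finset.card_le_one.2 fun a ha b hb => by rw [hex a ha, hex b hb]
      have hle : S.card * Bd k n (i.1 + 1) ≤ Bd k n (i.1 + 1) := by
        calc _ ≤ 1 * Bd k n (i.1 + 1) := Nat.mul_le_mul_right _ hS1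
          _ = _ := one_mul _
      refine hle.trans ?_
      by_cases hi : i.1 + 1 < n
      · obtain ⟨α, β, ⟨f, l, hl, hc, hj'k, hj'l, hfull⟩, hD⟩ := hF j' hj'
        obtain ⟨hf1, hf2⟩ := full_inj hfull
        obtain ⟨f', h1, h2⟩ := hl.next hk3 hodd hi
        have := step hk hn hk3 hG hj h1 (m := ⟨0, hk⟩) (α := α) (β := β) ?_ (by simp) ?_ hD
        · simp only [Fml.quant]
          simp only at this
          omega
        · intro j'' hj'' hne
          obtain ⟨h3, h4⟩ := hc j'' hj''
          refine ⟨h3, ?_⟩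
          obtain ⟨m, hm⟩ := hf1 j'' hj''
          have hml : m ≠ l := by
            rintro rfl
            exact hne (hf2 _ hj'' _ hj (by rw [hm, hj'l]))
          rw [h4, hm, h2 m hml]
        · intro j'' hj'' _ he
          obtain ⟨m, hm⟩ := hf1 j'' hj''
          rw [hm] at he
          have := congrArg (fun x => x.1.1) he
          simp at this
      · have : n - (i.1 + 1) = 0 := by omega
        simp [Bd, this, Fml.quant]

theorem good_mono {ψ ψ' : Fml (xorSig (Fin n × Vk k) (Gk k) (chainF k n hk hn))}
    (hq : ψ.quant = ψ'.quant)
    (hd : ∀ α β, Dist (SA hk hn) (SB hk hn) ψ' α β → Dist (SA hk hn) (SB hk hn) ψ α β)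
    (h : Good hk hn ψ) : Good hk hn ψ' := by
  refine ⟨fun i α β h1 h2 => hq ▸ h.1 i α β h1 (hd _ _ h2), fun i S h1 h2 => ?_⟩
  refine hq ▸ h.2 i S h1 fun j hj => ?_
  obtain ⟨α, β, h3, h4⟩ := h2 j hj
  exact ⟨α, β, h3, hd _ _ h4⟩

theorem good_split {ψ ψ1 ψ2 : Fml (xorSig (Fin n × Vk k) (Gk k) (chainF k n hk hn))}
    (hq : ψ.quant = ψ1.quant + ψ2.quant)
    (hd : ∀ α β, Dist (SA hk hn) (SB hk hn) ψ α β →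
      Dist (SA hk hn) (SB hk hn) ψ1 α β ∨ Dist (SA hk hn) (SB hk hn) ψ2 α β)
    (h1 : Good hk hn ψ1) (h2 : Good hk hn ψ2) : Good hk hn ψ := by
  classical
  constructor
  · intro i α β hN hD
    rcases hd _ _ hD with hD | hD
    · have := h1.1 i α β hN hD; omega
    · have := h2.1 i α β hN hD; omega
  · intro i S hS hF
    let P : ℕ → Prop := fun j => ∃ α β, Full hk i j α β ∧ Dist (SA hk hn) (SB hk hn) ψ1 α β
    have e1 := h1.2 i (S.filter P) ((Finset.card_filter_le _ _).trans hS)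
      (fun j hj => (Finset.mem_filter.1 hj).2)
    have e2 := h2.2 i (S.filter fun j => ¬ P j) ((Finset.card_filter_le _ _).trans hS) ?_
    · rw [hq, ← Finset.card_filter_add_card_filter_not (s := S) P, add_mul]
      exact add_le_add e1 e2
    · intro j hj
      obtain ⟨hjS, hjP⟩ := Finset.mem_filter.1 hj
      obtain ⟨α, β, h3, h4⟩ := hF j hjS
      rcases hd _ _ h4 with h5 | h5
      · exact (hjP ⟨α, β, h3, h5⟩).elim
      · exact ⟨α, β, h3, h5⟩

theorem good_atom {ψ : Fml (xorSig (Fin n × Vk k) (Gk k) (chainF k n hk hn))}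
    (h : ∀ f α β i l, Lvl hk f i l → (∀ j < k, Compat f (α j) (β j)) →
      ¬ ((∃ j < k, (α j).1 = (i, Sum.inr l)) ∧
        ∀ m, m ≠ l → ∃ j < k, (α j).1 = (i, Sum.inl m)) →
      ¬ Dist (SA hk hn) (SB hk hn) ψ α β) : Good hk hn ψ := by
  constructor
  · rintro i α β ⟨f, l, m, hl, hc, hm, hp⟩ hD
    exact (h f α β i l hl hc (NF.cov hm hp) hD).elim
  · intro i S _ hF
    rcases S.eq_empty_or_nonempty with rfl | ⟨j, hj⟩
    · simp
    · obtain ⟨α, β, ⟨f, l, hl, hc, -, -, hfull⟩, hD⟩ := hF j hj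
      exact (h f α β i l hl hc (Full.cov hfull) hD).elim

theorem good_all (hk3 : 3 ≤ k) (hodd : Odd k)
    (ψ : Fml (xorSig (Fin n × Vk k) (Gk k) (chainF k n hk hn))) :
    UsesVars k ψ → Good hk hn ψ := by
  induction ψ with
  | eq a b =>
    intro hv
    refine good_atom hk hn fun f α β i l _ hc _ => atom_eq hk hn hc ?_ ?_
    · exact hv a (by simp [Fml.vars])
    · exact hv b (by simp [Fml.vars])
  | rel R v =>
    intro hv
    refine good_atom hk hn fun f α β i l hl hc hcov => atom_rel hk hn hl hc hcov R v fun a => ?_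
    exact hv _ (by simp [Fml.vars])
  | not φ ih =>
    intro hv
    refine good_mono hk hn (ψ := φ) rfl (fun α β h => ?_) (ih hv)
    unfold Dist at *
    simp only [Fml.Sat] at h
    tauto
  | and φ ψ ih1 ih2 =>
    intro hv
    refine good_split hk hn rfl (fun α β h => ?_) (ih1 fun i hi => hv i (by simp [Fml.vars, hi]))
      (ih2 fun i hi => hv i (by simp [Fml.vars, hi]))
    unfold Dist at *
    simp only [Fml.Sat] at h
    tauto
  | or φ ψ ih1 ih2 =>
    intro hv
    refine good_split hk hn rfl (fun α β h => ?_) (ih1 fun i hi => hv i (by simp [Fml.vars, hi]))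
      (ih2 fun i hi => hv i (by simp [Fml.vars, hi]))
    unfold Dist at *
    simp only [Fml.Sat] at h
    tauto
  | ex j φ ih =>
    intro hv
    exact good_ex hk hn hk3 hodd (ih fun i hi => hv i (by simp [Fml.vars, hi]))
      (hv j (by simp [Fml.vars]))
  | all j φ ih =>
    intro hv
    have h1 : Good hk hn (.not φ) := by
      refine good_mono hk hn (ψ := φ) rfl (fun α β h => ?_)
        (ih fun i hi => hv i (by simp [Fml.vars, hi]))
      unfold Dist at *
      simp only [Fml.Sat] at h
      tauto
    have h2 := good_ex hk hn hk3 hodd h1 (hv j (by simp [Fml.vars]))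
    refine good_mono hk hn (ψ := .ex j (.not φ)) rfl (fun α β h => ?_) h2
    unfold Dist at *
    simp only [Fml.Sat] at h ⊢
    rw [← not_forall, ← not_forall, not_iff_not]
    exact h

end game

/-- Proposition 31 + Theorem 1 of the paper. For every odd `k ≥ 3`
and every `n ≥ 1`, the structures `𝒞 = 𝒜(𝓕)` and `𝒟 = ℬ(𝓕)` built from the chained
formula `𝓕` with `n` links agree on every sentence `φ` of `L^k` with
`quant φ ≤ (k-1)^n`. -/
theorem statement_17 (k : ℕ) (hk : 3 ≤ k) (hkodd : Odd k) (n : ℕ) (hn : 0 < n)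
    (φ : Fml (xorSig (Fin n × Vk k) (Gk k) (chainF k n (by omega) hn)))
    (hvars : UsesVars k φ) (hsent : IsSentence φ)
    (hquant : φ.quant ≤ (k - 1) ^ n) :
    AgreeOn
      (Astruct (Fin n × Vk k) (Gk k) (chainF k n (by omega) hn)
        (chainD k n (by omega) hn))
      (Bstruct (Fin n × Vk k) (Gk k) (chainF k n (by omega) hn)) φ := by
  have hk0 : 0 < k := by omega
  have hG := good_all hk0 hn hk hkodd φ hvars
  let α : ℕ → (Fin n × Vk k) × Gk k := fun _ => ((⟨0, hn⟩, Sum.inr ⟨0, hk0⟩), 0)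
  have hNF : NF hk0 ⟨0, hn⟩ α α := by
    refine ⟨_, _, ⟨0, hk0⟩, Lvl.start hk0 hk hn, fun j _ => ⟨rfl, ?_⟩, by simp, fun j _ => ?_⟩
    · simp [α]
    · simp [α]
  have hnd : ¬ Dist (SA hk0 hn) (SB hk0 hn) φ α α := by
    intro hD
    have := hG.1 _ _ _ hNF hD
    simp only [Bd, Nat.sub_zero] at this
    omega
  unfold Dist at hnd
  rw [not_not] at hnd
  have hfree : ∀ (M : Struct (xorSig (Fin n × Vk k) (Gk k) (chainF k n hk0 hn)))
      (a : ℕ → M.carrier), SatS M φ ↔ Fml.Sat M a φ := by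
    intro M a
    refine ⟨fun h => h a, fun h f => (sat_congr M φ f a fun i hi => ?_).2 h⟩
    have h0 : φ.freeVars = ∅ := hsent
    rw [h0] at hi
    simp at hi
  unfold AgreeOn
  rw [hfree (SA hk0 hn) α, hfree (SB hk0 hn) α]
  exact hnd

end QVT
end

section
/- For every odd k ≥ 3 there is a constant c (depending only on k) such that for every n ≥ 1 there is a sentence φ of L^{k+1} over the common signature of 𝒞 and 𝒟 with |φ| ≤ c·n such that 𝒞 ⊨ φ and 𝒟 ⊭ φ; moreover φ is logically equivalent, over all structures of this signature, to some sentence of L^k. Here 𝒞 = 𝒜(𝓕) and 𝒟 = ℬ(𝓕) are the structures built from the chained formula 𝓕 with n links. -/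
namespace QVT

/-! ### Helper constructions -/

section Generic

variable {σ : Signature}

/-- A false formula. -/
def fFalse (σ : Signature) : Fml σ := .not (.eq 0 0)

/-- Finite conjunction over a list. -/
def lAnd {ι : Type} (g : ι → Fml σ) : List ι → Fml σ
  | [] => .eq 0 0
  | i :: l => .and (g i) (lAnd g l)

/-- Finite disjunction over a list. -/
def lOr {ι : Type} (g : ι → Fml σ) : List ι → Fml σ
  | [] => fFalse σ
  | i :: l => .or (g i) (lOr g l)

/-- A block of existential quantifiers. -/
def exs : List ℕ → Fml σ → Fml σ
  | [], φ => φ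
  | i :: l, φ => .ex i (exs l φ)

theorem sat_lAnd {ι : Type} (M : Struct σ) (f : ℕ → M.carrier) (g : ι → Fml σ) (l : List ι) :
    Fml.Sat M f (lAnd g l) ↔ ∀ i ∈ l, Fml.Sat M f (g i) := by
  induction l with
  | nil => simp [lAnd, Fml.Sat]
  | cons i l ih => simp [lAnd, Fml.Sat, ih]

theorem sat_lOr {ι : Type} (M : Struct σ) (f : ℕ → M.carrier) (g : ι → Fml σ) (l : List ι) :
    Fml.Sat M f (lOr g l) ↔ ∃ i ∈ l, Fml.Sat M f (g i) := by
  induction l with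
  | nil => simp [lOr, fFalse, Fml.Sat]
  | cons i l ih => simp [lOr, Fml.Sat, ih]

theorem sat_exs (M : Struct σ) (φ : Fml σ) (l : List ℕ) (f : ℕ → M.carrier) :
    Fml.Sat M f (exs l φ) ↔ ∃ g : ℕ → M.carrier, (∀ i, i ∉ l → g i = f i) ∧ Fml.Sat M g φ := by
  induction l generalizing f with
  | nil =>
    constructor
    · intro h; exact ⟨f, fun _ _ => rfl, h⟩
    · rintro ⟨g, hg, h⟩
      have : g = f := funext fun i => hg i (by simp)
      rw [← this]; exact h
  | cons i l ih =>
    simp only [exs, Fml.Sat, ih]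
    constructor
    · rintro ⟨a, g, hg, h⟩
      refine ⟨g, fun x hx => ?_, h⟩
      simp only [List.mem_cons, not_or] at hx
      rw [hg x hx.2, Function.update_of_ne hx.1]
    · rintro ⟨g, hg, h⟩
      refine ⟨g i, g, fun x hx => ?_, h⟩
      by_cases hxi : x = i
      · subst hxi; simp
      · rw [Function.update_of_ne hxi]; exact hg x (by simp [hxi, hx])

theorem uses_lAnd {ι : Type} {m : ℕ} (hm : 0 < m) (g : ι → Fml σ) (l : List ι)
    (h : ∀ i ∈ l, UsesVars m (g i)) : UsesVars m (lAnd g l) := by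
  induction l with
  | nil => simpa [lAnd, UsesVars, Fml.vars] using hm
  | cons i l ih =>
    intro x hx
    simp only [lAnd, Fml.vars, Finset.mem_union] at hx
    rcases hx with hx | hx
    · exact h i (by simp) x hx
    · exact ih (fun i hi => h i (by simp [hi])) x hx

theorem uses_lOr {ι : Type} {m : ℕ} (hm : 0 < m) (g : ι → Fml σ) (l : List ι)
    (h : ∀ i ∈ l, UsesVars m (g i)) : UsesVars m (lOr g l) := by
  induction l with
  | nil => simpa [lOr, fFalse, UsesVars, Fml.vars] using hm
  | cons i l ih =>
    intro x hx
    simp only [lOr, Fml.vars, Finset.mem_union] at hx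
    rcases hx with hx | hx
    · exact h i (by simp) x hx
    · exact ih (fun i hi => h i (by simp [hi])) x hx

theorem uses_and {m : ℕ} {φ ψ : Fml σ} (h1 : UsesVars m φ) (h2 : UsesVars m ψ) :
    UsesVars m (.and φ ψ) := by
  intro x hx
  simp only [Fml.vars, Finset.mem_union] at hx
  exact hx.elim (h1 x) (h2 x)

theorem uses_or {m : ℕ} {φ ψ : Fml σ} (h1 : UsesVars m φ) (h2 : UsesVars m ψ) :
    UsesVars m (.or φ ψ) := by
  intro x hx
  simp only [Fml.vars, Finset.mem_union] at hx
  exact hx.elim (h1 x) (h2 x)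

theorem uses_not {m : ℕ} {φ : Fml σ} (h1 : UsesVars m φ) : UsesVars m (.not φ) := h1

theorem uses_ex {m i : ℕ} {φ : Fml σ} (hi : i < m) (h1 : UsesVars m φ) :
    UsesVars m (.ex i φ) := by
  intro x hx
  simp only [Fml.vars, Finset.mem_insert] at hx
  rcases hx with rfl | hx
  · exact hi
  · exact h1 x hx

theorem uses_all {m i : ℕ} {φ : Fml σ} (hi : i < m) (h1 : UsesVars m φ) :
    UsesVars m (.all i φ) := by
  intro x hx
  simp only [Fml.vars, Finset.mem_insert] at hx
  rcases hx with rfl | hx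
  · exact hi
  · exact h1 x hx

theorem uses_eq {m i j : ℕ} (hi : i < m) (hj : j < m) : UsesVars m (.eq i j : Fml σ) := by
  intro x hx
  simp only [Fml.vars, Finset.mem_insert, Finset.mem_singleton] at hx
  rcases hx with rfl | rfl <;> assumption

theorem uses_exs {m : ℕ} {φ : Fml σ} (l : List ℕ) (hl : ∀ i ∈ l, i < m) (h : UsesVars m φ) :
    UsesVars m (exs l φ) := by
  induction l with
  | nil => exact h
  | cons i l ih => exact uses_ex (hl i (by simp)) (ih fun j hj => hl j (by simp [hj]))

theorem uses_mono {m m' : ℕ} {φ : Fml σ} (hm : m ≤ m') (h : UsesVars m φ) : UsesVars m' φ :=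
  fun i hi => (h i hi).trans_le hm

theorem freeVars_subset (φ : Fml σ) : φ.freeVars ⊆ φ.vars := by
  induction φ with
  | eq i j => exact subset_rfl
  | rel R v => exact subset_rfl
  | not φ ih => exact ih
  | and φ ψ h1 h2 => exact Finset.union_subset_union h1 h2
  | or φ ψ h1 h2 => exact Finset.union_subset_union h1 h2
  | ex i φ ih =>
    exact (Finset.erase_subset _ _).trans (ih.trans (Finset.subset_insert _ _))
  | all i φ ih =>
    exact (Finset.erase_subset _ _).trans (ih.trans (Finset.subset_insert _ _))

theorem freeVars_exs (l : List ℕ) (φ : Fml σ) (x : ℕ) (hx : x ∈ (exs l φ).freeVars) :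
    x ∈ φ.freeVars ∧ x ∉ l := by
  induction l with
  | nil => exact ⟨hx, by simp⟩
  | cons i l ih =>
    simp only [exs, Fml.freeVars, Finset.mem_erase] at hx
    have := ih hx.2
    exact ⟨this.1, by simp [hx.1, this.2]⟩

theorem sentence_exs {m : ℕ} {φ : Fml σ} (h : UsesVars m φ) :
    IsSentence (exs (List.range m) φ) := by
  refine Finset.eq_empty_of_forall_notMem fun x hx => ?_
  obtain ⟨h1, h2⟩ := freeVars_exs _ _ _ hx
  exact h2 (List.mem_range.2 (h x (freeVars_subset φ h1)))

theorem size_lAnd {ι : Type} {b : ℕ} (g : ι → Fml σ) (l : List ι)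
    (h : ∀ i ∈ l, (g i).size ≤ b) : (lAnd g l).size ≤ 4 + l.length * (b + 1) := by
  induction l with
  | nil => simp [lAnd, Fml.size]
  | cons i l ih =>
    have h1 := h i (by simp)
    have h2 := ih fun j hj => h j (by simp [hj])
    simp only [lAnd, Fml.size, List.length_cons, Nat.add_mul]
    omega

theorem size_lOr {ι : Type} {b : ℕ} (g : ι → Fml σ) (l : List ι)
    (h : ∀ i ∈ l, (g i).size ≤ b) : (lOr g l).size ≤ 4 + l.length * (b + 1) := by
  induction l with
  | nil => simp [lOr, fFalse, Fml.size]
  | cons i l ih =>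
    have h1 := h i (by simp)
    have h2 := ih fun j hj => h j (by simp [hj])
    simp only [lOr, Fml.size, List.length_cons, Nat.add_mul]
    omega

theorem size_exs (l : List ℕ) (φ : Fml σ) : (exs l φ).size = φ.size + 2 * l.length := by
  induction l with
  | nil => simp [exs]
  | cons i l ih => simp only [exs, Fml.size, ih, List.length_cons]; omega

end Generic

section Chain

variable {k n : ℕ}

/-- Constraints over the chained variables. -/
abbrev Con (k n : ℕ) : Type := Constraint (Fin n × Vk k) (Gk k)

/-- The signature for a set of constraints. -/
@[reducible] def Sg {k n : ℕ} (F : Finset (Con k n)) : Signature :=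
  xorSig (Fin n × Vk k) (Gk k) F

/-- The distinguishing clause. -/
def cTop (hk : 0 < k) (hn : 0 < n) : Con k n := ⟨[((⟨0, hn⟩ : Fin n), Sum.inl ⟨0, hk⟩)], ODD k⟩
/-- `s_i(j)` is even. -/
def cEv (j : Fin n) (i : Fin k) : Con k n := ⟨[(j, Sum.inl i)], EVEN k⟩
/-- The long clause. -/
noncomputable def cE (j : Fin n) (l : Fin k) : Con k n :=
  ⟨(j, Sum.inr l) :: (Finset.univ.erase l).toList.map (fun i : Fin k => (j, Sum.inl i)),
    {g : Gk k | g l = 0}⟩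
/-- `s_i(j)[i] = 0`. -/
def cZ (j : Fin n) (i : Fin k) : Con k n := ⟨[(j, Sum.inl i)], {g : Gk k | g i = 0}⟩
/-- `e_l(j)[i] = 0`. -/
def cEz (j : Fin n) (l i : Fin k) : Con k n := ⟨[(j, Sum.inr l)], {g : Gk k | g i = 0}⟩
/-- The link clause. -/
def cL (hk : 0 < k) (j : Fin n) (l : Fin k) : Con k n :=
  ⟨[(j, Sum.inr l), (succIdx j, Sum.inl ⟨0, hk⟩)], EVEN k⟩

variable (F : Finset (Con k n))

open scoped Classical in
/-- The atom of the constraint `C` with variables renamed by `w` (false if `C ∉ F`). -/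
noncomputable def atm (C : Con k n) (w : Fin n × Vk k → ℕ) : Fml (Sg F) :=
  if h : C ∈ F then .rel (Sum.inr ⟨C, h⟩) (fun m : Fin C.vars.length => w (C.vars.get m))
  else fFalse _

variable {F} in
/-- Semantic version of `atm`. -/
def satC (M : Struct (Sg F)) (C : Con k n) (val : Fin n × Vk k → M.carrier) : Prop :=
  ∃ h : C ∈ F, M.rel (Sum.inr ⟨C, h⟩) (fun m : Fin C.vars.length => val (C.vars.get m))

variable {F} in
theorem sat_atm (M : Struct (Sg F)) (f : ℕ → M.carrier) (C : Con k n) (w : Fin n × Vk k → ℕ) :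
    Fml.Sat M f (atm F C w) ↔ satC M C (fun x => f (w x)) := by
  unfold atm satC
  by_cases h : C ∈ F
  · simp [h, Fml.Sat]
  · simp [h, Fml.Sat, fFalse]

variable {F} in
theorem satC_congr (M : Struct (Sg F)) (C : Con k n) (v v' : Fin n × Vk k → M.carrier)
    (h : ∀ x ∈ C.vars, v x = v' x) : satC M C v ↔ satC M C v' := by
  unfold satC
  have : (fun m : Fin C.vars.length => v (C.vars.get m)) = fun m => v' (C.vars.get m) :=
    funext fun m => h _ (List.get_mem _ _)
  rw [this]

theorem uses_atm {m : ℕ} (C : Con k n) (w : Fin n × Vk k → ℕ)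
    (hm : 0 < m) (h : ∀ x ∈ C.vars, w x < m) : UsesVars m (atm F C w) := by
  unfold atm
  split
  · intro x hx
    simp only [Fml.vars, Finset.mem_image, Finset.mem_univ, true_and] at hx
    obtain ⟨a, rfl⟩ := hx
    exact h _ (List.get_mem _ _)
  · simpa [fFalse, UsesVars, Fml.vars] using hm

theorem size_atm (C : Con k n) (w : Fin n × Vk k → ℕ) :
    (atm F C w).size ≤ 4 + C.vars.length := by
  unfold atm
  split
  · simp [Fml.size]
  · simp [fFalse, Fml.size]

/-- Valuation sending `s_i` to `s i` and every `e_l` to `e`. -/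
def vv {α : Type} (s : Fin k → α) (e : α) : Fin n × Vk k → α := fun x => Sum.elim s (fun _ => e) x.2

/-- Conjunction of the unary clauses on the `s_i(j)`. -/
noncomputable def fBeta (hk : 0 < k) (j : Fin n) : Fml (Sg F) :=
  lAnd (fun i : Fin k => .and (atm F (cZ j i) (vv (fun i : Fin k => i.1) 0))
    (if i = ⟨0, hk⟩ then .eq 0 0 else atm F (cEv j i) (vv (fun i : Fin k => i.1) 0)))
    (List.finRange k)

/-- The guard for `e_l(j)` stored in variable `v`. -/
noncomputable def fAlpha (j : Fin n) (l : Fin k) (v : ℕ) : Fml (Sg F) :=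
  .and (atm F (cE j l) (vv (fun i : Fin k => i.1) v))
    (lAnd (fun i : Fin k => if i = l then .eq 0 0
      else atm F (cEz j l i) (vv (fun i : Fin k => i.1) v)) (List.finRange k))

/-- The last-link clause. -/
noncomputable def fLast (j : Fin n) (v : ℕ) : Fml (Sg F) :=
  lOr (fun l : Fin k => atm F (cEz j l l) (vv (fun _ : Fin k => 0) v)) (List.finRange k)

/-- The linking clauses with `e` in variable `v` and `s_1` in variable `y`. -/
noncomputable def fLink (hk : 0 < k) (j : Fin n) (v y : ℕ) : Fml (Sg F) :=
  lOr (fun l : Fin k => atm F (cL hk j l) (vv (fun _ : Fin k => y) v)) (List.finRange k)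

/-- The chain formula with `k+1` variables. -/
noncomputable def fTheta (hk : 0 < k) : ℕ → Fin n → Fml (Sg F)
  | 0, _ => fFalse _
  | m + 1, j => exs (List.range' 1 (k - 1)) (.and (fBeta F hk j)
      (.all k (.or (.not (lOr (fun l : Fin k => fAlpha F j l k) (List.finRange k)))
        (.or (fLast F j k) (.ex 0 (.and (fLink F hk j k 0) (fTheta hk m (succIdx j))))))))

/-- An auxiliary variable different from `0` and `l`. -/
def yv (l : ℕ) : ℕ := if l = 1 then 2 else 1

/-- The chain formula with `k` variables. -/
noncomputable def fPsi (hk : 0 < k) : ℕ → Fin n → Fml (Sg F)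
  | 0, _ => fFalse _
  | m + 1, j => exs (List.range' 1 (k - 1)) (.and (fBeta F hk j)
      (lAnd (fun l : Fin k => .all l.1 (.or (.not (fAlpha F j l l.1))
        (.or (fLast F j l.1) (.ex (yv l.1) (.and (fLink F hk j l.1 (yv l.1))
          (.ex 0 (.and (.eq 0 (yv l.1)) (fPsi hk m (succIdx j)))))))))
        (List.finRange k)))

variable {F}

/-- Semantic version of `fBeta`. -/
def sBeta (hk : 0 < k) (M : Struct (Sg F)) (j : Fin n) (s : Fin k → M.carrier) : Prop :=
  ∀ i, satC M (cZ j i) (fun _ => s i) ∧ (i ≠ ⟨0, hk⟩ → satC M (cEv j i) (fun _ => s i))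

/-- Semantic version of `fAlpha`. -/
def sAlpha (M : Struct (Sg F)) (j : Fin n) (l : Fin k) (e : M.carrier)
    (s : Fin k → M.carrier) : Prop :=
  satC M (cE j l) (vv s e) ∧ ∀ i, i ≠ l → satC M (cEz j l i) (fun _ => e)

/-- Semantic version of `fLink`. -/
def sLink (hk : 0 < k) (M : Struct (Sg F)) (j : Fin n) (e y : M.carrier) : Prop :=
  ∃ l : Fin k, satC M (cL hk j l) (vv (fun _ => y) e)

/-- Semantic version of `fLast`. -/
def sLast (M : Struct (Sg F)) (j : Fin n) (e : M.carrier) : Prop :=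
  ∃ l : Fin k, satC M (cEz j l l) (fun _ => e)

/-- Semantic version of both chain formulas. -/
def sTheta (hk : 0 < k) (M : Struct (Sg F)) : ℕ → Fin n → M.carrier → Prop
  | 0, _, _ => False
  | m + 1, j, a => ∃ s : Fin k → M.carrier, s ⟨0, hk⟩ = a ∧ sBeta hk M j s ∧
      ∀ e, (∃ l, sAlpha M j l e s) →
        (sLast M j e ∨ ∃ y, sLink hk M j e y ∧ sTheta hk M m (succIdx j) y)

theorem sat_fBeta (hk : 0 < k) (M : Struct (Sg F)) (j : Fin n) (f : ℕ → M.carrier) :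
    Fml.Sat M f (fBeta F hk j) ↔ sBeta hk M j (fun i => f i.1) := by
  unfold fBeta sBeta
  rw [sat_lAnd]
  simp only [List.mem_finRange, true_imp_iff]
  refine forall_congr' fun i => ?_
  simp only [Fml.Sat]
  refine and_congr ?_ ?_
  · rw [sat_atm]; apply satC_congr; simp [cZ, vv]
  · by_cases h : i = ⟨0, hk⟩
    · simp [h, Fml.Sat]
    · simp only [h, if_false, ne_eq, not_false_eq_true, true_imp_iff]
      rw [sat_atm]; apply satC_congr; simp [cEv, vv]

theorem sat_fAlpha (M : Struct (Sg F)) (j : Fin n) (l : Fin k) (v : ℕ) (f : ℕ → M.carrier)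
    (s : Fin k → M.carrier) (e : M.carrier) (he : f v = e) (hs : ∀ i, i ≠ l → f i.1 = s i) :
    Fml.Sat M f (fAlpha F j l v) ↔ sAlpha M j l e s := by
  unfold fAlpha sAlpha
  simp only [Fml.Sat]
  rw [sat_lAnd, sat_atm]
  simp only [List.mem_finRange, true_imp_iff]
  refine and_congr ?_ (forall_congr' fun i => ?_)
  · apply satC_congr
    intro x hx
    simp only [cE, List.mem_cons, List.mem_map, Finset.mem_toList, Finset.mem_erase,
      Finset.mem_univ, and_true] at hx
    rcases hx with rfl | ⟨i, hi, rfl⟩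
    · simpa [vv] using he
    · simpa [vv] using hs i hi
  · by_cases h : i = l
    · simp [h, Fml.Sat]
    · simp only [h, if_false, ne_eq, not_false_eq_true, true_imp_iff]
      rw [sat_atm]; apply satC_congr; simp [cEz, vv, he]

theorem sat_fLast (M : Struct (Sg F)) (j : Fin n) (v : ℕ) (f : ℕ → M.carrier) :
    Fml.Sat M f (fLast F j v) ↔ sLast M j (f v) := by
  unfold fLast sLast
  rw [sat_lOr]
  simp only [List.mem_finRange, true_and]
  refine exists_congr fun l => ?_
  rw [sat_atm]; apply satC_congr; simp [cEz, vv]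

theorem sat_fLink (hk : 0 < k) (M : Struct (Sg F)) (j : Fin n) (v y : ℕ) (f : ℕ → M.carrier) :
    Fml.Sat M f (fLink F hk j v y) ↔ sLink hk M j (f v) (f y) := by
  unfold fLink sLink
  rw [sat_lOr]
  simp only [List.mem_finRange, true_and]
  refine exists_congr fun l => ?_
  rw [sat_atm]; apply satC_congr; simp [cL, vv]

/-- Blocks of quantifiers over `s_2, …, s_k`. -/
theorem sat_block (hk : 0 < k) (M : Struct (Sg F)) (f : ℕ → M.carrier) (φ : Fml (Sg F))
    (P : (Fin k → M.carrier) → Prop)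
    (h : ∀ g : ℕ → M.carrier, Fml.Sat M g φ ↔ P (fun i => g i.1)) :
    Fml.Sat M f (exs (List.range' 1 (k - 1)) φ) ↔
      ∃ s : Fin k → M.carrier, s ⟨0, hk⟩ = f 0 ∧ P s := by
  rw [sat_exs]
  constructor
  · rintro ⟨g, hg, hs⟩
    exact ⟨fun i => g i.1, hg 0 (by simp), (h g).1 hs⟩
  · rintro ⟨s, hs, hP⟩
    refine ⟨fun i => if hi : i < k then s ⟨i, hi⟩ else f i, fun i hi => ?_, (h _).2 ?_⟩
    · rw [List.mem_range'_1] at hi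
      by_cases hik : i < k
      · have : i = 0 := by omega
        subst this
        simp [hk, hs]
      · simp [hik]
    · simpa using hP

theorem sat_fTheta (hk : 0 < k) (M : Struct (Sg F)) (m : ℕ) (j : Fin n) (f : ℕ → M.carrier) :
    Fml.Sat M f (fTheta F hk m j) ↔ sTheta hk M m j (f 0) := by
  induction m generalizing j f with
  | zero => simp [fTheta, sTheta, fFalse, Fml.Sat]
  | succ m ih =>
    unfold fTheta sTheta
    apply sat_block
    intro g
    simp only [Fml.Sat]
    rw [sat_fBeta]
    refine and_congr Iff.rfl (forall_congr' fun e => ?_)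
    rw [sat_lOr, sat_fLast, imp_iff_not_or]
    refine or_congr (not_congr ?_) (or_congr (by simp) (exists_congr fun y => ?_))
    · simp only [List.mem_finRange, true_and]
      refine exists_congr fun l => sat_fAlpha M j l k _ _ _ (by simp) fun i _ => ?_
      rw [Function.update_of_ne (by have := i.2; omega)]
    · rw [sat_fLink, ih]
      simp [Function.update_of_ne hk.ne']

theorem sat_fPsi (hk : 0 < k) (M : Struct (Sg F)) (m : ℕ) (j : Fin n) (f : ℕ → M.carrier) :
    Fml.Sat M f (fPsi F hk m j) ↔ sTheta hk M m j (f 0) := by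
  induction m generalizing j f with
  | zero => simp [fPsi, sTheta, fFalse, Fml.Sat]
  | succ m ih =>
    unfold fPsi sTheta
    apply sat_block
    intro g
    simp only [Fml.Sat]
    rw [sat_fBeta, sat_lAnd]
    refine and_congr Iff.rfl ?_
    have key : ∀ (l : Fin k) (e : M.carrier),
        Fml.Sat M (Function.update g l.1 e) (.or (.not (fAlpha F j l l.1))
          (.or (fLast F j l.1) (.ex (yv l.1) (.and (fLink F hk j l.1 (yv l.1))
          (.ex 0 (.and (.eq 0 (yv l.1)) (fPsi F hk m (succIdx j)))))))) ↔
        (sAlpha M j l e (fun i => g i.1) →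
          (sLast M j e ∨ ∃ y, sLink hk M j e y ∧ sTheta hk M m (succIdx j) y)) := by
      intro l e
      simp only [Fml.Sat]
      rw [sat_fLast, imp_iff_not_or]
      refine or_congr (not_congr ?_) (or_congr (by simp) (exists_congr fun y => ?_))
      · refine sat_fAlpha M j l l.1 _ _ _ (by simp) fun i hi => ?_
        rw [Function.update_of_ne (fun h => hi (Fin.ext h))]
      · have h1 : l.1 ≠ yv l.1 := by unfold yv; split <;> omega
        have h2 : yv l.1 ≠ 0 := by unfold yv; split <;> omega
        rw [sat_fLink]
        simp only [ih]
        simp [Function.update_of_ne h1, Function.update_of_ne h2]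
    simp only [List.mem_finRange, true_imp_iff]
    constructor
    · rintro h e ⟨l, hl⟩
      exact (key l e).1 (h l e) hl
    · intro h l e
      exact (key l e).2 fun hl => h e ⟨l, hl⟩

/-! ### Variables and sizes -/

variable (F)

theorem uses_fBeta (hk : 0 < k) (j : Fin n) : UsesVars k (fBeta F hk j) := by
  refine uses_lAnd hk _ _ fun i _ => uses_and (uses_atm F _ _ hk ?_) ?_
  · simp [cZ, vv]
  · split
    · exact uses_eq hk hk
    · exact uses_atm F _ _ hk (by simp [cEv, vv])

theorem uses_fAlpha {m : ℕ} (hk : 0 < k) (hm : k ≤ m) (j : Fin n) (l : Fin k) (v : ℕ)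
    (hv : v < m) : UsesVars m (fAlpha F j l v) := by
  have hm0 : 0 < m := by omega
  refine uses_and (uses_atm F _ _ hm0 ?_) (uses_lAnd hm0 _ _ fun i _ => ?_)
  · rintro ⟨_, i | i⟩ _
    · exact i.2.trans_le hm
    · exact hv
  · split
    · exact uses_eq hm0 hm0
    · exact uses_atm F _ _ hm0 (by simpa [cEz, vv] using hv)

theorem uses_fLast {m : ℕ} (j : Fin n) (v : ℕ) (hv : v < m) : UsesVars m (fLast F j v) := by
  have hm0 : 0 < m := by omega
  exact uses_lOr hm0 _ _ fun i _ => uses_atm F _ _ hm0 (by simpa [cEz, vv] using hv)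

theorem uses_fLink {m : ℕ} (hk : 0 < k) (j : Fin n) (v y : ℕ) (hv : v < m) (hy : y < m) :
    UsesVars m (fLink F hk j v y) := by
  have hm0 : 0 < m := by omega
  exact uses_lOr hm0 _ _ fun i _ => uses_atm F _ _ hm0 (by simp [cL, vv, hv, hy])

theorem uses_fTheta (hk : 0 < k) (m : ℕ) (j : Fin n) : UsesVars (k + 1) (fTheta F hk m j) := by
  induction m generalizing j with
  | zero => exact uses_not (uses_eq (by omega) (by omega))
  | succ m ih =>
    refine uses_exs _ (fun i hi => ?_) (uses_and (uses_mono (by omega) (uses_fBeta F hk j))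
      (uses_all (by omega) (uses_or (uses_not (uses_lOr (by omega) _ _ fun l _ => ?_))
        (uses_or (uses_fLast F j k (by omega)) (uses_ex (by omega)
          (uses_and (uses_fLink F hk j k 0 (by omega) (by omega)) (ih _)))))))
    · rw [List.mem_range'_1] at hi; omega
    · exact uses_fAlpha F hk (by omega) j l k (by omega)

theorem uses_fPsi (hk : 0 < k) (hk3 : 3 ≤ k) (m : ℕ) (j : Fin n) :
    UsesVars k (fPsi F hk m j) := by
  induction m generalizing j with
  | zero => exact uses_not (uses_eq (by omega) (by omega))
  | succ m ih =>
    have hy : ∀ l, yv l < k := by intro l; unfold yv; split <;> omega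
    refine uses_exs _ (fun i hi => ?_) (uses_and (uses_fBeta F hk j)
      (uses_lAnd hk _ _ fun l _ => uses_all l.2 (uses_or (uses_not
        (uses_fAlpha F hk le_rfl j l l.1 l.2))
        (uses_or (uses_fLast F j l.1 l.2) (uses_ex (hy _)
          (uses_and (uses_fLink F hk j l.1 _ l.2 (hy _))
            (uses_ex hk (uses_and (uses_eq hk (hy _)) (ih _)))))))))
    rw [List.mem_range'_1] at hi; omega

theorem size_fBeta (hk : 0 < k) (j : Fin n) : (fBeta F hk j).size ≤ 4 + k * 12 := by
  have := size_lAnd (b := 11) (fun i : Fin k => Fml.and (atm F (cZ j i) (vv (fun i : Fin k => i.1) 0))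
    (if i = ⟨0, hk⟩ then .eq 0 0 else atm F (cEv j i) (vv (fun i : Fin k => i.1) 0)))
    (List.finRange k) (fun i _ => by
      have h1 := size_atm F (cZ j i) (vv (fun i : Fin k => i.1) 0)
      have h2 := size_atm F (cEv j i) (vv (fun i : Fin k => i.1) 0)
      simp only [cZ, cEv, List.length_singleton] at h1 h2
      simp only [Fml.size]
      split
      · simp only [Fml.size, cZ]; omega
      · simp only [cZ, cEv]; omega)
  simpa [fBeta] using this

theorem size_fAlpha (j : Fin n) (l : Fin k) (v : ℕ) :
    (fAlpha F j l v).size ≤ 9 + k + k * 6 := by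
  have h0 := size_lAnd (b := 5) (fun i : Fin k => if i = l then (Fml.eq 0 0 : Fml (Sg F))
      else atm F (cEz j l i) (vv (fun i : Fin k => i.1) v)) (List.finRange k) (fun i _ => by
      have h1 := size_atm F (cEz j l i) (vv (fun i : Fin k => i.1) v)
      simp only [cEz, List.length_singleton] at h1
      split
      · simp [Fml.size]
      · exact h1)
  have h1 := size_atm F (cE j l) (vv (fun i : Fin k => i.1) v)
  have h2 : (cE j l : Con k n).vars.length = k := by
    have := l.2
    simp [cE]
    omega
  rw [h2] at h1
  rw [List.length_finRange] at h0
  simp only [fAlpha, Fml.size]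
  omega

theorem size_fLast (j : Fin n) (v : ℕ) : (fLast F j v).size ≤ 4 + k * 6 := by
  have := size_lOr (b := 5) (fun l : Fin k => atm F (cEz j l l) (vv (fun _ : Fin k => 0) v))
    (List.finRange k) (fun i _ => size_atm F (cEz j i i) _)
  simpa [fLast] using this

theorem size_fLink (hk : 0 < k) (j : Fin n) (v y : ℕ) : (fLink F hk j v y).size ≤ 4 + k * 7 := by
  have := size_lOr (b := 6) (fun l : Fin k => atm F (cL hk j l) (vv (fun _ : Fin k => y) v))
    (List.finRange k) (fun i _ => size_atm F (cL hk j i) _)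
  simpa [fLink] using this

theorem size_fTheta (hk : 0 < k) (m : ℕ) (j : Fin n) :
    (fTheta F hk m j).size ≤ 4 + m * (100 + 100 * k + k * (k + k * 6 + 10)) := by
  induction m generalizing j with
  | zero => simp [fTheta, fFalse, Fml.size]
  | succ m ih =>
    have h1 := size_fBeta F hk j
    have h2 := size_lOr (fun l : Fin k => fAlpha F j l k) (List.finRange k)
      (fun l _ => size_fAlpha F j l k)
    have h3 := size_fLast F j k
    have h4 := size_fLink F hk j k 0
    have h5 := ih (succIdx j)
    have h6 : k * (9 + k + k * 6 + 1) = k * (k + k * 6 + 10) := by ring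
    rw [List.length_finRange, h6] at h2
    simp only [fTheta, size_exs, Fml.size, List.length_range', Nat.add_mul, Nat.one_mul] at h5 ⊢
    omega

variable {F}

/-! ### The structures -/

theorem satC_mk (Hf : Con k n → Set (Gk k)) (C : Con k n) (val : Fin n × Vk k → (Fin n × Vk k) × Gk k) :
    satC (mkXorStruct (Fin n × Vk k) (Gk k) F Hf) C val ↔
      C ∈ F ∧ (∀ x ∈ C.vars, (val x).1 = x) ∧ (C.vars.map fun x => (val x).2).sum ∈ Hf C := by
  unfold satC
  have hsum : ∑ i : Fin C.vars.length, (val (C.vars.get i)).2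
      = (C.vars.map fun x => (val x).2).sum := by
    rw [← List.sum_ofFn]
    congr 1
    apply List.ext_getElem <;> simp
  constructor
  · rintro ⟨h, h1, h2⟩
    refine ⟨h, fun x hx => ?_, ?_⟩
    · obtain ⟨i, rfl⟩ := List.get_of_mem hx
      exact h1 i
    · rw [← hsum]; exact h2
  · rintro ⟨h, h1, h2⟩
    refine ⟨h, fun i => h1 _ (List.get_mem _ _), ?_⟩
    rw [← hsum] at h2; exact h2

variable (hk : 0 < k) (hn : 0 < n)

theorem mem_cTop : cTop hk hn ∈ chainF k n hk hn := by
  simp [chainF, cTop]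

theorem mem_cEv (j : Fin n) (i : Fin k) (hi : i ≠ ⟨0, hk⟩) : cEv j i ∈ chainF k n hk hn := by
  unfold chainF
  simp only [Finset.mem_union]
  refine Or.inl (Or.inl (Or.inl (Or.inl (Or.inr ?_))))
  classical
  exact Finset.mem_image.2 ⟨(j, i), by simpa using hi, rfl⟩

theorem mem_cE (j : Fin n) (l : Fin k) : cE j l ∈ chainF k n hk hn := by
  unfold chainF
  simp only [Finset.mem_union]
  refine Or.inl (Or.inl (Or.inl (Or.inr ?_)))
  classical
  exact Finset.mem_image.2 ⟨(j, l), by simp, rfl⟩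

theorem mem_cZ (j : Fin n) (l : Fin k) : cZ j l ∈ chainF k n hk hn := by
  unfold chainF
  simp only [Finset.mem_union]
  refine Or.inl (Or.inl (Or.inr ?_))
  classical
  exact Finset.mem_image.2 ⟨(j, l), by simp, rfl⟩

theorem mem_cEz (j : Fin n) (l i : Fin k) (h : i ≠ l ∨ j.1 + 1 = n) :
    cEz j l i ∈ chainF k n hk hn := by
  unfold chainF
  simp only [Finset.mem_union]
  refine Or.inl (Or.inr ?_)
  classical
  refine Finset.mem_image.2 ⟨(j, l, i), ?_, rfl⟩
  simp only [Finset.mem_filter, Finset.mem_univ, true_and]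
  exact h.imp id fun h => Fin.ext (by simp only; omega)

theorem mem_cL (j : Fin n) (l : Fin k) (h : j.1 + 1 < n) : cL hk j l ∈ chainF k n hk hn := by
  unfold chainF
  simp only [Finset.mem_union]
  refine Or.inr ?_
  classical
  exact Finset.mem_image.2 ⟨(j, l), by simpa using h, rfl⟩

theorem hatH_eq (C : Con k n) (h : (0 : Gk k) ∈ C.H) : hatH (chainD k n hk hn) C = C.H := by
  have hC : C ∉ chainD k n hk hn := by
    rintro rfl
    simp [ODD] at h
  ext g
  simp [hatH, hC]

/-- Completeness in `𝒞`. -/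
theorem complete (m : ℕ) (j : Fin n) (hm : j.1 + m = n) :
    sTheta hk (Astruct (Fin n × Vk k) (Gk k) (chainF k n hk hn) (chainD k n hk hn)) m j
      ((j, Sum.inl ⟨0, hk⟩), 0) := by
  induction m generalizing j with
  | zero => have := j.2; omega
  | succ m ih =>
    refine ⟨fun i => ((j, Sum.inl i), 0), rfl, fun i => ⟨?_, fun hi => ?_⟩, ?_⟩
    · rw [satC_mk]
      refine ⟨mem_cZ hk hn j i, by simp [cZ], ?_⟩
      rw [hatH_eq] <;> simp [cZ]
    · rw [satC_mk]
      refine ⟨mem_cEv hk hn j i hi, by simp [cEv], ?_⟩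
      rw [hatH_eq] <;> simp [cEv, EVEN]
    · rintro e ⟨l, h1, h2⟩
      rw [satC_mk] at h1
      obtain ⟨-, h1a, h1b⟩ := h1
      rw [hatH_eq _ _ _ (by simp [cE])] at h1b
      have he1 : e.1 = (j, Sum.inr l) := h1a (j, Sum.inr l) (by simp [cE])
      have he2 : e.2 = 0 := by
        funext i
        by_cases hi : i = l
        · subst hi
          simpa [cE, vv, Function.comp_def] using h1b
        · have := h2 i hi
          rw [satC_mk, hatH_eq _ _ _ (by simp [cEz])] at this
          simpa [cEz] using this.2.2
      by_cases hj : j.1 + 1 < n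
      · right
        refine ⟨((succIdx j, Sum.inl ⟨0, hk⟩), 0), ⟨l, ?_⟩, ih _ ?_⟩
        · rw [satC_mk]
          refine ⟨mem_cL hk hn j l hj, by simp [cL, vv, he1], ?_⟩
          rw [hatH_eq] <;> simp [cL, vv, EVEN, he2]
        · simp only [succIdx, hj, dif_pos]; omega
      · left
        refine ⟨l, ?_⟩
        rw [satC_mk]
        have := j.2
        refine ⟨mem_cEz hk hn j l l (Or.inr (by omega)), by simp [cEz, he1], ?_⟩
        rw [hatH_eq] <;> simp [cEz, he2]

/-- Soundness in `𝒟`. -/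
theorem sound (m : ℕ) (j : Fin n) (a : (Fin n × Vk k) × Gk k)
    (h : sTheta hk (Bstruct (Fin n × Vk k) (Gk k) (chainF k n hk hn)) m j a) :
    ∑ i, a.2 i = 0 := by
  induction m generalizing j a with
  | zero => exact h.elim
  | succ m ih =>
    obtain ⟨s, hs0, hs, hE⟩ := h
    by_contra hne
    have hs1 : ∀ i, (s i).1 = (j, Sum.inl i) := by
      intro i
      have := (hs i).1
      rw [satC_mk] at this
      exact this.2.1 _ (by simp [cZ])
    have hs2 : ∀ i, (s i).2 i = 0 := by
      intro i
      have := (hs i).1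
      rw [satC_mk] at this
      simpa [cZ] using this.2.2
    have hs3 : ∀ i, i ≠ ⟨0, hk⟩ → ∑ l, (s i).2 l = 0 := by
      intro i hi
      have := (hs i).2 hi
      rw [satC_mk] at this
      simpa [cEv, EVEN] using this.2.2
    have htot : ∑ l, ∑ i, (s i).2 l ≠ 0 := by
      rw [Finset.sum_comm, Finset.sum_eq_single ⟨0, hk⟩ (fun i _ hi => hs3 i hi) (by simp), hs0]
      exact hne
    obtain ⟨l, -, hl⟩ := Finset.exists_ne_zero_of_sum_ne_zero htot
    have two : ∀ x : ZMod 2, x ≠ 0 → x = 1 := by decide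
    have hl1 : ∑ i ∈ Finset.univ.erase l, (s i).2 l = 1 := by
      rw [← Finset.add_sum_erase _ _ (Finset.mem_univ l), hs2 l, zero_add] at hl
      exact two _ hl
    have hα : sAlpha (Bstruct (Fin n × Vk k) (Gk k) (chainF k n hk hn)) j l
        ((j, Sum.inr l), Pi.single l 1) s := by
      refine ⟨?_, fun i hi => ?_⟩
      · rw [satC_mk]
        refine ⟨mem_cE hk hn j l, ?_, ?_⟩
        · simp [cE, vv, hs1]
        · have h3 : ((Finset.univ.erase l).toList.map fun i => (s i).2).sum l
              = ∑ i ∈ Finset.univ.erase l, (s i).2 l := by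
            rw [Finset.sum_map_toList, Finset.sum_apply]
          have h4 : (1 : ZMod 2) + 1 = 0 := by decide
          simp only [cE, vv, List.map_cons, List.map_map, List.sum_cons, Set.mem_setOf_eq,
            Function.comp_def, Sum.elim_inl, Sum.elim_inr, Pi.add_apply, Pi.single_eq_same]
          rw [h3, hl1, h4]
      · rw [satC_mk]
        refine ⟨mem_cEz hk hn j l i (Or.inl hi), by simp [cEz], ?_⟩
        simp [cEz, hi]
    rcases hE _ ⟨l, hα⟩ with ⟨l', h⟩ | ⟨y, ⟨l', h⟩, hy⟩
    · rw [satC_mk] at h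
      obtain ⟨-, h1, h2⟩ := h
      have : l = l' := by simpa [cEz] using h1
      subst this
      simp [cEz] at h2
    · have hy0 := ih _ _ hy
      rw [satC_mk] at h
      have h2 := h.2.2
      simp [cL, vv, EVEN, Finset.sum_add_distrib, hy0] at h2

end Chain

/-- Section 5.4 of the paper. For every odd `k ≥ 3` there is a
constant `c` such that for every `n ≥ 1` there is a sentence `φ` of `L^{k+1}` of size
at most `c * n` which distinguishes `𝒞 = 𝒜(𝓕)` from `𝒟 = ℬ(𝓕)` and which is
logically equivalent (over all finite nonempty structures of the signature) to some
sentence of `L^k`. -/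
theorem statement_18 (k : ℕ) (hk : 3 ≤ k) (hkodd : Odd k) :
    ∃ c : ℕ, 0 < c ∧ ∀ n : ℕ, ∀ hn : 0 < n,
      ∃ φ : Fml (xorSig (Fin n × Vk k) (Gk k) (chainF k n (by omega) hn)),
        UsesVars (k + 1) φ ∧ IsSentence φ ∧ φ.size ≤ c * n ∧
        Distinguishes
          (Astruct (Fin n × Vk k) (Gk k) (chainF k n (by omega) hn)
            (chainD k n (by omega) hn))
          (Bstruct (Fin n × Vk k) (Gk k) (chainF k n (by omega) hn)) φ ∧
        ∃ ψ : Fml (xorSig (Fin n × Vk k) (Gk k) (chainF k n (by omega) hn)),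
          UsesVars k ψ ∧ IsSentence ψ ∧
          ∀ M : Struct (xorSig (Fin n × Vk k) (Gk k) (chainF k n (by omega) hn)),
            Finite M.carrier → Nonempty M.carrier → (SatS M φ ↔ SatS M ψ) := by
  have hk0 : 0 < k := by omega
  refine ⟨200 + 200 * k + k * (k + k * 6 + 10), by omega, fun n hn => ?_⟩
  set F := chainF k n hk0 hn with hF
  have u0 : ∀ m, 0 < m → UsesVars m (atm F (cTop hk0 hn) (fun _ => 0)) :=
    fun m hm => uses_atm F _ _ hm (fun _ _ => hm)
  have u1 := uses_and (u0 (k + 1) (by omega)) (uses_fTheta F hk0 n ⟨0, hn⟩)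
  have u2 := uses_and (u0 k hk0) (uses_fPsi F hk0 hk n ⟨0, hn⟩)
  have sem : ∀ (M : Struct (Sg F)) (m : ℕ) (f : ℕ → M.carrier) (θ : Fml (Sg F)), 0 < m →
      (∀ g : ℕ → M.carrier, Fml.Sat M g θ ↔ sTheta hk0 M n ⟨0, hn⟩ (g 0)) →
      (Fml.Sat M f (exs (List.range m) (.and (atm F (cTop hk0 hn) (fun _ => 0)) θ)) ↔
        ∃ a, satC M (cTop hk0 hn) (fun _ => a) ∧ sTheta hk0 M n ⟨0, hn⟩ a) := by
    intro M m f θ hm hθ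
    rw [sat_exs]
    simp only [Fml.Sat, sat_atm, hθ]
    constructor
    · rintro ⟨g, -, h⟩
      exact ⟨g 0, h⟩
    · rintro ⟨a, h⟩
      refine ⟨Function.update f 0 a, fun i hi => ?_, by simpa using h⟩
      rw [Function.update_of_ne]
      rintro rfl
      exact hi (List.mem_range.2 hm)
  have sem1 := fun (M : Struct (Sg F)) f => sem M (k + 1) f _ (by omega)
    (sat_fTheta hk0 M n ⟨0, hn⟩)
  have sem2 := fun (M : Struct (Sg F)) f => sem M k f _ hk0 (sat_fPsi hk0 M n ⟨0, hn⟩)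
  refine ⟨exs (List.range (k + 1)) (.and (atm F (cTop hk0 hn) (fun _ => 0))
    (fTheta F hk0 n ⟨0, hn⟩)), uses_exs _ (fun i hi => List.mem_range.1 hi) u1,
    sentence_exs u1, ?_, ⟨?_, ?_⟩, exs (List.range k) (.and (atm F (cTop hk0 hn) (fun _ => 0))
    (fPsi F hk0 n ⟨0, hn⟩)), uses_exs _ (fun i hi => List.mem_range.1 hi) u2,
    sentence_exs u2, ?_⟩
  · have h1 := size_fTheta F hk0 n ⟨0, hn⟩
    have h2 := size_atm F (cTop hk0 hn) (fun _ => 0)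
    have h3 : (cTop hk0 hn).vars.length = 1 := rfl
    rw [h3] at h2
    simp only [size_exs, Fml.size, List.length_range]
    have h4 : (200 + 200 * k + k * (k + k * 6 + 10)) * n =
      n * (100 + 100 * k + k * (k + k * 6 + 10)) + (100 + 100 * k) * n := by ring
    have h5 : 100 + 100 * k ≤ (100 + 100 * k) * n := Nat.le_mul_of_pos_right _ hn
    omega
  · intro f
    refine (sem1 _ f).2 ⟨((⟨0, hn⟩, Sum.inl ⟨0, hk0⟩), 0), ?_, complete hk0 hn n ⟨0, hn⟩ (by simp)⟩
    rw [satC_mk]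
    refine ⟨mem_cTop hk0 hn, by simp [cTop], ?_⟩
    simp [hatH, cTop, ODD, chainD]
  · intro h
    obtain ⟨a, h1, h2⟩ := (sem1 _ _).1 (h fun _ => ((⟨0, hn⟩, Sum.inl ⟨0, hk0⟩), 0))
    have h3 := sound hk0 hn _ _ _ h2
    rw [satC_mk] at h1
    have h4 := h1.2.2
    simp [cTop, ODD, h3] at h4
  · intro M _ _
    exact forall_congr' fun f => (sem1 M f).trans (sem2 M f).symm

end QVT
end
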